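/- arXiv:2002.05416 — 2 statements merged into one kernel-verified Lean document; each statement's English description precedes it below -/
import Mathlib

section
/- Well-posedness of the controlled polyhedral sweeping process: Let T > 0 and let assumptions (H1)–(H4) hold for the data U, a_i, b_i, g. Fix control actions a = (a_1,…,a_m) ∈ W^{1,2}([0,T];ℝ^{mn}), b = (b_1,…,b_m) ∈ W^{1,2}([0,T];ℝ^m) and a measurable u ∈ L²([0,T];ℝ^d) with u(t) ∈ U for a.e. t ∈ [0,T], and let x₀ ∈ C(a(0),b(0)). Then there exists a unique x ∈ W^{1,2}([0,T];ℝ^n) such that x(0) = x₀ and ẋ(t) ∈ −N(x(t); C(a(t),b(t))) + g(x(t),u(t)) for a.e. t ∈ [0,T]. -/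
open MeasureTheory Set Filter
open scoped RealInnerProductSpace Topology

noncomputable section

abbrev En (n : ℕ) : Type := EuclideanSpace ℝ (Fin n)

/-- Convex normal cone: empty when `x ∉ C`. -/
def normalCone {E : Type*} [NormedAddCommGroup E] [InnerProductSpace ℝ E]
    (C : Set E) (x : E) : Set E :=
  {v | x ∈ C ∧ ∀ y ∈ C, ⟪v, y - x⟫ ≤ 0}

/-- The moving polyhedron `C(a,b)`. -/
def polyhedron {n m : ℕ} (a : Fin m → En n) (b : Fin m → ℝ) : Set (En n) :=
  {x | ∀ i, ⟪a i, x⟫ ≤ b i}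

/-- Active constraint indices. -/
def activeIndex {n m : ℕ} (a : Fin m → En n) (b : Fin m → ℝ) (x : En n) : Set (Fin m) :=
  {i | ⟪a i, x⟫ = b i}

/-- Positive linear independence of `{a i : i ∈ I}`. -/
def PosLinIndepOn {n m : ℕ} (a : Fin m → En n) (I : Set (Fin m)) : Prop :=
  ∀ α : Fin m → ℝ, (∀ i, 0 ≤ α i) → (∀ i, i ∉ I → α i = 0) →
    (∑ i, α i • a i) = 0 → ∀ i ∈ I, α i = 0

/-- Linear independence of `{a i : i ∈ I}`. -/
def LinIndepOnSet {n m : ℕ} (a : Fin m → En n) (I : Set (Fin m)) : Prop :=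
  ∀ α : Fin m → ℝ, (∀ i, i ∉ I → α i = 0) → (∑ i, α i • a i) = 0 → ∀ i, α i = 0

/-- `f ∈ W^{1,2}([0,T];E)` with derivative `f'`: `f'` is in `L²` on `[0,T]` and `f` is the
indefinite (Bochner) integral of `f'`, i.e. `f` is absolutely continuous with a.e. derivative `f'`. -/
def IsW12On {E : Type*} [NormedAddCommGroup E] [NormedSpace ℝ E] [CompleteSpace E]
    (T : ℝ) (f f' : ℝ → E) : Prop :=
  MemLp f' 2 (volume.restrict (Icc (0:ℝ) T)) ∧
  ∀ t ∈ Icc (0:ℝ) T, f t = f 0 + ∫ s in (0:ℝ)..t, f' s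

/-- The projection set `Π(z;Ω)`. -/
def projSet {E : Type*} [NormedAddCommGroup E] (Ω : Set E) (z : E) : Set E :=
  {y | y ∈ Ω ∧ dist z y = Metric.infDist z Ω}

/-- The limiting (Mordukhovich) normal cone. -/
def limNormalCone {E : Type*} [NormedAddCommGroup E] [NormedSpace ℝ E]
    (Ω : Set E) (zb : E) : Set E :=
  {v | ∃ zs vs : ℕ → E, Tendsto zs atTop (𝓝 zb) ∧ Tendsto vs atTop (𝓝 v) ∧
    ∀ k, ∃ lam : ℝ, 0 ≤ lam ∧ ∃ y ∈ projSet Ω (zs k), vs k = lam • (zs k - y)}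

/-- The coderivative of a set-valued mapping. -/
def coderiv {E F : Type*} [NormedAddCommGroup E] [NormedSpace ℝ E]
    [NormedAddCommGroup F] [NormedSpace ℝ F]
    (S : E → Set F) (zb : E) (yb : F) (u : F) : Set E :=
  {v | (v, -u) ∈ limNormalCone {p : E × F | p.2 ∈ S p.1} (zb, yb)}

/-- The limiting subdifferential of an extended-real-valued (here real-valued) function. -/
def limSubdiff {E : Type*} [NormedAddCommGroup E] [NormedSpace ℝ E]
    (h : E → ℝ) (z : E) : Set E :=
  {v | (v, (-1 : ℝ)) ∈ limNormalCone {p : E × ℝ | h p.1 ≤ p.2} (z, h z)}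

/-- The nonpositive orthant `ℝ^m_-`. -/
def negOrthant (m : ℕ) : Set (En m) := {x | ∀ i, x i ≤ 0}

/-- The normal cone mapping `x ↦ N(x;ℝ^m_-)`. -/
def NnegOrthant (m : ℕ) : En m → Set (En m) := fun x => normalCone (negOrthant m) x

/-- `A x`, where `A` is the matrix with rows `a i`. -/
def Aop {n m : ℕ} (a : Fin m → En n) (x : En n) : En m := WithLp.toLp 2 (fun i => ⟪a i, x⟫)

/-- `Aᵀ q`. -/
def ATop {n m : ℕ} (a : Fin m → En n) (q : En m) : En n := ∑ i, q i • a i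

/-- The normal cone mapping `G(x,a,b) = N(x;C(a,b))` as a set-valued map on the product space. -/
def Gmap (n m : ℕ) : (En n × (Fin m → En n) × En m) → Set (En n) :=
  fun z => normalCone (polyhedron z.2.1 (fun i => z.2.2 i)) z.1

/-- The sweeping velocity mapping `F(x,a,b,u) = N(x;C(a,b)) - g(x,u)` as a set-valued map. -/
def FmapSV {n m d : ℕ} (g : En n → En d → En n) :
    (En n × (Fin m → En n) × En m × En d) → Set (En n) :=
  fun z => (fun v => v - g z.1 z.2.2.2) '' normalCone (polyhedron z.2.1 (fun i => z.2.2.1 i)) z.1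

section SweepingProcess

variable {E : Type*} [NormedAddCommGroup E] [InnerProductSpace ℝ E]

theorem norm_sub_sq_le_of_inner_nonpos {v p y : E} (h : ⟪v - p, y - p⟫ ≤ 0) :
    ‖p - y‖ ^ 2 ≤ ‖v - y‖ ^ 2 := by
  have h1 : v - y = (v - p) - (y - p) := by abel
  have h2 : ‖p - y‖ = ‖y - p‖ := norm_sub_rev _ _
  rw [h2, h1, norm_sub_sq_real (v - p)]
  nlinarith [sq_nonneg ‖v - p‖]

theorem norm_sub_le_of_inner_nonpos {v p y : E} (h : ⟪v - p, y - p⟫ ≤ 0) :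
    ‖p - y‖ ≤ ‖v - y‖ :=
  le_of_sq_le_sq (norm_sub_sq_le_of_inner_nonpos h) (norm_nonneg _)

theorem LipschitzWith.eq_add_integral_deriv [FiniteDimensional ℝ E] {x : ℝ → E} {K : NNReal}
    (hx : LipschitzWith K x) (t : ℝ) : x t = x 0 + ∫ s in (0 : ℝ)..t, deriv x s := by
  have hinteg : LocallyIntegrable (deriv x) volume :=
    (locallyIntegrable_const (K : ℝ)).mono (stronglyMeasurable_deriv x).aestronglyMeasurable
      (Eventually.of_forall fun s => by
        simpa using norm_deriv_le_of_lipschitz hx)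
  have hii : ∀ p q, IntervalIntegrable (deriv x) volume p q := fun p q =>
    intervalIntegrable_iff.2
      ((hinteg.integrableOn_isCompact isCompact_uIcc).mono_set uIoc_subset_uIcc)
  have hI : LipschitzWith K fun s => ∫ σ in (0 : ℝ)..s, deriv x σ := by
    refine LipschitzWith.of_dist_le_mul fun p q => ?_
    rw [dist_eq_norm, intervalIntegral.integral_interval_sub_left (hii _ _) (hii _ _),
      Real.dist_eq]
    exact intervalIntegral.norm_integral_le_of_norm_le_const fun s _ =>
      norm_deriv_le_of_lipschitz hx
  obtain ⟨c, hc⟩ := ((hx.sub hI).lipschitzOnWith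
    (s := uIcc 0 t)).absolutelyContinuousOnInterval.const_of_ae_hasDerivAt_zero (by
      filter_upwards [hx.ae_differentiableAt_real,
        LocallyIntegrable.ae_hasDerivAt_integral hinteg] with s h1 h2 _
      exact (h1.hasDerivAt.sub (h2 0)).congr_deriv (sub_self _))
  have h0 := hc 0 left_mem_uIcc
  have ht := hc t right_mem_uIcc
  simp only [intervalIntegral.integral_same, sub_zero] at h0 ht
  rw [h0, ← ht]; abel

/-- A vector field that is measurable in time and, uniformly in time, Lipschitz and of linear
growth in space. -/
structure IsLipschitzCaratheodory [MeasurableSpace E] (f : E → ℝ → E) (L M : ℝ) : Prop where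
  measurable : ∀ x, Measurable (f x)
  lipschitz : ∀ x y t, ‖f x t - f y t‖ ≤ L * ‖x - y‖
  growth : ∀ x t, ‖f x t‖ ≤ M * (1 + ‖x‖)

/-- A moving closed convex set that has a bounded Lipschitz selection and is Lipschitz in time on
every ball. -/
structure IsMovingConvexSet (C : ℝ → Set E) : Prop where
  convex : ∀ t, Convex ℝ (C t)
  isClosed : ∀ t, IsClosed (C t)
  selection : ∃ (z : ℝ → E) (R ρ : ℝ), (∀ t, z t ∈ C t) ∧ (∀ t, ‖z t‖ ≤ R) ∧
    ∀ s t, ‖z t - z s‖ ≤ ρ * |t - s|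
  lipschitz : ∀ r, ∃ κ ≥ (0 : ℝ), ∀ s t, ∀ x ∈ C s, ‖x‖ ≤ r → ∃ y ∈ C t, ‖x - y‖ ≤ κ * |t - s|

theorem IsMovingConvexSet.exists_projection [CompleteSpace E] {C : ℝ → Set E}
    (hC : IsMovingConvexSet C) :
    ∃ P : ℝ → E → E, ∀ t v, P t v ∈ C t ∧ ∀ y ∈ C t, ⟪v - P t v, y - P t v⟫ ≤ 0 := by
  obtain ⟨z, -, -, hz, -⟩ := hC.selection
  have h : ∀ t v, ∃ p, p ∈ C t ∧ ∀ y ∈ C t, ⟪v - p, y - p⟫ ≤ 0 := fun t v => by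
    obtain ⟨p, hp, hpm⟩ := exists_norm_eq_iInf_of_complete_convex ⟨z t, hz t⟩
      (hC.isClosed t).isComplete (hC.convex t) v
    exact ⟨p, hp, (norm_eq_iInf_iff_real_inner_le_zero (hC.convex t) hp).1 hpm⟩
  choose P hP using h
  exact ⟨P, hP⟩

namespace IsLipschitzCaratheodory

variable [MeasurableSpace E] {f : E → ℝ → E} {L M : ℝ}

theorem norm_integral_le (hf : IsLipschitzCaratheodory f L M) (x : E) (p q : ℝ) :
    ‖∫ s in p..q, f x s‖ ≤ M * (1 + ‖x‖) * |q - p| :=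
  intervalIntegral.norm_integral_le_of_norm_le_const fun s _ => hf.growth x s

variable [FiniteDimensional ℝ E] [BorelSpace E]

theorem intervalIntegrable (hf : IsLipschitzCaratheodory f L M) (x : E) (p q : ℝ) :
    IntervalIntegrable (f x) volume p q :=
  (intervalIntegrable_const (c := M * (1 + ‖x‖))).mono_fun
    (hf.measurable x).aestronglyMeasurable
    (Eventually.of_forall fun t => (hf.growth x t).trans (le_abs_self _))

theorem norm_integral_sub_le (hf : IsLipschitzCaratheodory f L M) (x y : E) (p q : ℝ) :
    ‖(∫ s in p..q, f x s) - ∫ s in p..q, f y s‖ ≤ L * ‖x - y‖ * |q - p| := by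
  rw [← intervalIntegral.integral_sub (hf.intervalIntegrable x p q) (hf.intervalIntegrable y p q)]
  exact intervalIntegral.norm_integral_le_of_norm_le_const fun s _ => hf.lipschitz x y s

theorem tendsto_integral (hf : IsLipschitzCaratheodory f L M) {ι : Type*} {l : Filter ι}
    {ξ : ι → E} {p q : ι → ℝ} {x : E} {a b : ℝ} (hξ : Tendsto ξ l (𝓝 x))
    (hp : Tendsto p l (𝓝 a)) (hq : Tendsto q l (𝓝 b)) :
    Tendsto (fun i => ∫ s in (p i)..(q i), f (ξ i) s) l (𝓝 (∫ s in a..b, f x s)) := by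
  have h1 : Tendsto (fun i => ∫ s in (p i)..(q i), f x s) l (𝓝 (∫ s in a..b, f x s)) := by
    have hc := intervalIntegral.continuous_primitive (hf.intervalIntegrable x) 0
    have := ((hc.tendsto b).comp hq).sub ((hc.tendsto a).comp hp)
    simpa [Function.comp_def, intervalIntegral.integral_interval_sub_left,
      hf.intervalIntegrable x] using this
  have h2 : Tendsto (fun i => (∫ s in (p i)..(q i), f (ξ i) s) - ∫ s in (p i)..(q i), f x s) l
      (𝓝 0) := by
    refine squeeze_zero_norm (fun i => hf.norm_integral_sub_le (ξ i) x (p i) (q i)) ?_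
    have := ((tendsto_iff_norm_sub_tendsto_zero.1 hξ).const_mul L).mul (hq.sub hp).abs
    simpa using this
  simpa using h2.add h1

end IsLipschitzCaratheodory

/-- The catching-up algorithm with step `h`: follow the vector field for time `h` from a frozen
state, then apply `P`, which is meant to project onto the moving set at the new time. -/
def catchUp (f : E → ℝ → E) (P : ℝ → E → E) (x₀ : E) (h : ℝ) : ℕ → E
  | 0 => x₀
  | k + 1 => P ((k + 1 : ℕ) * h) (catchUp f P x₀ h k +
      ∫ s in ((k : ℕ) * h)..((k + 1 : ℕ) * h), f (catchUp f P x₀ h k) s)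

theorem catchUp_mem {C : ℝ → Set E} {f : E → ℝ → E} {P : ℝ → E → E} {x₀ : E}
    (hP : ∀ t v, P t v ∈ C t) (hx₀ : x₀ ∈ C 0) (h : ℝ) (k : ℕ) :
    catchUp f P x₀ h k ∈ C (k * h) := by
  cases k with
  | zero => simpa [catchUp] using hx₀
  | succ k => exact hP _ _

variable [MeasurableSpace E] {f : E → ℝ → E} {L M : ℝ} {C : ℝ → Set E}
  {P : ℝ → E → E} {x₀ : E}

theorem exists_bound_catchUp (hf : IsLipschitzCaratheodory f L M) (hM : 0 ≤ M)
    (hC : IsMovingConvexSet C)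
    (hP : ∀ t v, P t v ∈ C t ∧ ∀ y ∈ C t, ⟪v - P t v, y - P t v⟫ ≤ 0) (x₀ : E) (T : ℝ) :
    ∃ r, ∀ h > 0, ∀ k : ℕ, k * h ≤ T → ‖catchUp f P x₀ h k‖ ≤ r := by
  obtain ⟨z, R, ρ, hz, hzR, hzρ⟩ := hC.selection
  have hR : 0 ≤ R := (norm_nonneg _).trans (hzR 0)
  have hρ : 0 ≤ ρ := by simpa using (norm_nonneg _).trans (hzρ 0 1)
  set A := ρ + M * (1 + R) with hA
  have hA0 : 0 ≤ A := by positivity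
  refine ⟨R + Real.exp (M * T) * (‖x₀ - z 0‖ + T * A), fun h hh k hk => ?_⟩
  have key : ∀ k : ℕ, ‖catchUp f P x₀ h k - z (k * h)‖ ≤
      Real.exp (M * (k * h)) * (‖x₀ - z 0‖ + k * h * A) := by
    intro k
    induction k with
    | zero => simp [catchUp]
    | succ k ih =>
      set X := catchUp f P x₀ h k with hX
      set F := ∫ s in ((k : ℕ) * h)..((k + 1 : ℕ) * h), f X s with hF
      have hlen : ((k + 1 : ℕ) : ℝ) * h - k * h = h := by push_cast; ring
      have hFb : ‖F‖ ≤ M * (1 + ‖X‖) * h := by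
        have := hf.norm_integral_le X (k * h) ((k + 1 : ℕ) * h)
        rwa [hlen, abs_of_pos hh] at this
      have hzb : ‖z ((k + 1 : ℕ) * h) - z (k * h)‖ ≤ ρ * h := by
        have := hzρ (k * h) ((k + 1 : ℕ) * h)
        rwa [hlen, abs_of_pos hh] at this
      have h1 : ‖catchUp f P x₀ h (k + 1) - z ((k + 1 : ℕ) * h)‖ ≤
          ‖X + F - z ((k + 1 : ℕ) * h)‖ :=
        norm_sub_le_of_inner_nonpos ((hP _ _).2 _ (hz _))
      have h2 : ‖X + F - z ((k + 1 : ℕ) * h)‖ ≤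
          ‖X - z (k * h)‖ + ‖F‖ + ‖z ((k + 1 : ℕ) * h) - z (k * h)‖ := by
        have : X + F - z ((k + 1 : ℕ) * h) =
          (X - z (k * h)) + F - (z ((k + 1 : ℕ) * h) - z (k * h)) := by abel
        rw [this]
        exact (norm_sub_le _ _).trans (by gcongr; exact norm_add_le _ _)
      have h3 : ‖X‖ ≤ ‖X - z (k * h)‖ + R := by
        have := norm_add_le (X - z (k * h)) (z (k * h))
        rw [sub_add_cancel] at this
        linarith [hzR (k * h)]
      have h4 : ‖catchUp f P x₀ h (k + 1) - z ((k + 1 : ℕ) * h)‖ ≤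
          (1 + M * h) * ‖X - z (k * h)‖ + A * h := by
        have : M * (1 + ‖X‖) * h ≤ M * (1 + (‖X - z (k * h)‖ + R)) * h := by gcongr
        rw [hA]; linarith
      have h5 : 1 + M * h ≤ Real.exp (M * h) := by
        linarith [Real.add_one_le_exp (M * h)]
      have h6 : (1 : ℝ) ≤ Real.exp (M * ((k + 1 : ℕ) * h)) := Real.one_le_exp (by positivity)
      have h7 : Real.exp (M * ((k + 1 : ℕ) * h)) = Real.exp (M * h) * Real.exp (M * (k * h)) := by
        rw [← Real.exp_add]; congr 1; push_cast; ring
      calc _ ≤ (1 + M * h) * ‖X - z (k * h)‖ + A * h := h4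
        _ ≤ Real.exp (M * h) * (Real.exp (M * (k * h)) * (‖x₀ - z 0‖ + k * h * A)) +
            Real.exp (M * ((k + 1 : ℕ) * h)) * (A * h) := by
          refine add_le_add ?_ (le_mul_of_one_le_left (by positivity) h6)
          gcongr
        _ = _ := by rw [← mul_assoc, ← h7]; push_cast; ring
  have h1 := norm_add_le (catchUp f P x₀ h k - z (k * h)) (z (k * h))
  rw [sub_add_cancel] at h1
  have h2 : Real.exp (M * (k * h)) * (‖x₀ - z 0‖ + k * h * A) ≤
      Real.exp (M * T) * (‖x₀ - z 0‖ + T * A) := by gcongr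
  linarith [key k, hzR (k * h)]

theorem exists_lipschitz_catchUp (hf : IsLipschitzCaratheodory f L M) (hM : 0 ≤ M)
    (hC : IsMovingConvexSet C)
    (hP : ∀ t v, P t v ∈ C t ∧ ∀ y ∈ C t, ⟪v - P t v, y - P t v⟫ ≤ 0) (hx₀ : x₀ ∈ C 0)
    {T r : ℝ} (hr : ∀ h > 0, ∀ k : ℕ, k * h ≤ T → ‖catchUp f P x₀ h k‖ ≤ r) :
    ∃ Λ ≥ 0, ∀ h > 0, ∀ k j : ℕ, (k + j : ℕ) * h ≤ T →
      ‖catchUp f P x₀ h (k + j) - catchUp f P x₀ h k‖ ≤ Λ * (j * h) := by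
  obtain ⟨κ, hκ, hκC⟩ := hC.lipschitz r
  refine ⟨2 * κ + M * (1 + |r|), by positivity, fun h hh k j => ?_⟩
  induction j with
  | zero => simp
  | succ j ih =>
    intro hT
    have hT' : (k + j : ℕ) * h ≤ T := by push_cast at hT ⊢; linarith
    set i := k + j with hi
    set X := catchUp f P x₀ h i with hX
    set F := ∫ s in ((i : ℕ) * h)..((i + 1 : ℕ) * h), f X s with hF
    have hlen : ((i + 1 : ℕ) : ℝ) * h - i * h = h := by push_cast; ring
    have hXr : ‖X‖ ≤ r := hr h hh i hT'
    have hFb : ‖F‖ ≤ M * (1 + |r|) * h := by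
      have := hf.norm_integral_le X (i * h) ((i + 1 : ℕ) * h)
      rw [hlen, abs_of_pos hh] at this
      refine this.trans ?_
      have := hXr.trans (le_abs_self r)
      gcongr
    obtain ⟨y, hy, hXy⟩ := hκC (i * h) ((i + 1 : ℕ) * h) X
      (catchUp_mem (fun t v => (hP t v).1) hx₀ h i) hXr
    rw [hlen, abs_of_pos hh] at hXy
    have h1 : ‖catchUp f P x₀ h (i + 1) - y‖ ≤ ‖X + F - y‖ :=
      norm_sub_le_of_inner_nonpos ((hP _ _).2 _ hy)
    have h2 : ‖X + F - y‖ ≤ ‖X - y‖ + ‖F‖ := by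
      rw [add_sub_right_comm]; exact norm_add_le _ _
    have h3 := norm_sub_le_norm_sub_add_norm_sub (catchUp f P x₀ h (i + 1)) y X
    have h4 := norm_sub_le_norm_sub_add_norm_sub (catchUp f P x₀ h (i + 1)) X
      (catchUp f P x₀ h k)
    rw [norm_sub_rev y X] at h3
    have h5 := ih hT'
    change ‖catchUp f P x₀ h (i + 1) - _‖ ≤ _
    push_cast
    linarith

variable [FiniteDimensional ℝ E] [BorelSpace E]

theorem catchUp_evi (hf : IsLipschitzCaratheodory f L M) (hL : 0 ≤ L) (hM : 0 ≤ M)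
    (hP : ∀ t v, P t v ∈ C t ∧ ∀ y ∈ C t, ⟪v - P t v, y - P t v⟫ ≤ 0)
    {T r Λ h : ℝ} (hh : 0 < h) (hΛ : 0 ≤ Λ)
    (hr : ∀ k : ℕ, k * h ≤ T → ‖catchUp f P x₀ h k‖ ≤ r)
    (hlip : ∀ k j : ℕ, (k + j : ℕ) * h ≤ T →
      ‖catchUp f P x₀ h (k + j) - catchUp f P x₀ h k‖ ≤ Λ * (j * h))
    (y : E) (k j : ℕ) (hT : (k + j : ℕ) * h ≤ T)
    (hy : ∀ i : ℕ, k < i → i ≤ k + j → y ∈ C (i * h)) :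
    ‖catchUp f P x₀ h (k + j) - y‖ ^ 2 ≤ ‖catchUp f P x₀ h k - y‖ ^ 2 +
      2 * ⟪∫ s in ((k : ℕ) * h)..((k + j : ℕ) * h), f (catchUp f P x₀ h k) s,
        catchUp f P x₀ h k - y⟫ +
      ((M * (1 + r)) ^ 2 + 2 * L * Λ * (r + ‖y‖) + 2 * (M * (1 + r)) * Λ) * (j * h) ^ 2 := by
  induction j with
  | zero => simp
  | succ j ih =>
    have hT' : (k + j : ℕ) * h ≤ T := by push_cast at hT ⊢; linarith
    have ih := ih hT' fun i h1 h2 => hy i h1 (by omega)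
    have hkT : (k : ℕ) * h ≤ T := by
      push_cast at hT'
      have : (0 : ℝ) ≤ j * h := by positivity
      linarith
    have hlip := hlip k j hT'
    have hyi := hy (k + j + 1) (by omega) (by omega)
    have hXr := hr _ hT'
    have hX₀r := hr _ hkT
    change ‖catchUp f P x₀ h (k + j + 1) - y‖ ^ 2 ≤ _
    change _ ≤ _ + 2 * ⟪∫ s in ((k : ℕ) * h)..((k + j + 1 : ℕ) * h), _, _⟫ + _
    set i := k + j with hi
    set X₀ := catchUp f P x₀ h k with hX₀
    set X := catchUp f P x₀ h i with hX
    set F := ∫ s in ((i : ℕ) * h)..((i + 1 : ℕ) * h), f X s with hF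
    set F₀ := ∫ s in ((i : ℕ) * h)..((i + 1 : ℕ) * h), f X₀ s with hF₀
    set B := M * (1 + r) with hB
    have hr0 : 0 ≤ r := (norm_nonneg _).trans hXr
    have hB0 : 0 ≤ B := by positivity
    have hlen : ((i + 1 : ℕ) : ℝ) * h - i * h = h := by push_cast; ring
    have hFb : ‖F‖ ≤ B * h := by
      have := hf.norm_integral_le X (i * h) ((i + 1 : ℕ) * h)
      rw [hlen, abs_of_pos hh] at this
      exact this.trans (by rw [hB]; gcongr)
    have hFF₀ : ‖F - F₀‖ ≤ L * (Λ * (j * h)) * h := by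
      have := hf.norm_integral_sub_le X X₀ (i * h) ((i + 1 : ℕ) * h)
      rw [hlen, abs_of_pos hh] at this
      exact this.trans (by gcongr)
    have hsplit : (∫ s in ((k : ℕ) * h)..((i + 1 : ℕ) * h), f X₀ s) =
        (∫ s in ((k : ℕ) * h)..((i : ℕ) * h), f X₀ s) + F₀ :=
      (intervalIntegral.integral_add_adjacent_intervals (hf.intervalIntegrable _ _ _)
        (hf.intervalIntegrable _ _ _)).symm
    have h1 : ‖catchUp f P x₀ h (i + 1) - y‖ ^ 2 ≤ ‖X + F - y‖ ^ 2 :=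
      norm_sub_sq_le_of_inner_nonpos ((hP _ _).2 _ hyi)
    have h2 : ‖X + F - y‖ ^ 2 = ‖X - y‖ ^ 2 + 2 * ⟪F, X - y⟫ + ‖F‖ ^ 2 := by
      rw [add_sub_right_comm, norm_add_sq_real, real_inner_comm]
    have h3 : ⟪F, X - y⟫ = ⟪F₀, X₀ - y⟫ + ⟪F - F₀, X₀ - y⟫ + ⟪F, X - X₀⟫ := by
      simp only [inner_sub_left, inner_sub_right]; ring
    have h4 : ⟪F - F₀, X₀ - y⟫ ≤ L * (Λ * (j * h)) * h * (r + ‖y‖) :=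
      (real_inner_le_norm _ _).trans (by
        gcongr
        exact (norm_sub_le _ _).trans (by gcongr))
    have h5 : ⟪F, X - X₀⟫ ≤ B * h * (Λ * (j * h)) :=
      (real_inner_le_norm _ _).trans (by gcongr)
    have h6 : ‖F‖ ^ 2 ≤ (B * h) ^ 2 := by gcongr
    rw [hsplit, inner_add_left]
    push_cast
    have h7 : 0 ≤ L * Λ * (r + ‖y‖) * h ^ 2 := by positivity
    have h8 : 0 ≤ B * Λ * h ^ 2 := by positivity
    have h9 : 0 ≤ B ^ 2 * (j * h ^ 2) := by positivity
    have h10 : 0 ≤ L * Λ * (r + ‖y‖) * (j * h ^ 2) := by positivity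
    have h11 : 0 ≤ B * Λ * (j * h ^ 2) := by positivity
    nlinarith

theorem exists_evi_solution (hf : IsLipschitzCaratheodory f L M) (hL : 0 ≤ L) (hM : 0 ≤ M)
    (hC : IsMovingConvexSet C) (hx₀ : x₀ ∈ C 0) {T : ℝ} (hT : 0 ≤ T) :
    ∃ (x : ℝ → E) (Λ : ℝ), 0 ≤ Λ ∧
      (∀ s ∈ Icc 0 T, ∀ t ∈ Icc 0 T, ‖x t - x s‖ ≤ Λ * |t - s|) ∧ x 0 = x₀ ∧
      (∀ t ∈ Icc 0 T, x t ∈ C t) ∧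
      ∀ y, ∃ D, ∀ p ∈ Icc 0 T, ∀ q ∈ Icc 0 T, p ≤ q → (∀ s ∈ Icc p q, y ∈ C s) →
        ‖x q - y‖ ^ 2 ≤ ‖x p - y‖ ^ 2 + 2 * ⟪∫ s in p..q, f (x p) s, x p - y⟫ +
          D * (q - p) ^ 2 := by
  obtain ⟨P, hP⟩ := hC.exists_projection
  obtain ⟨r, hr⟩ := exists_bound_catchUp hf hM hC hP x₀ T
  obtain ⟨Λ, hΛ, hlip⟩ := exists_lipschitz_catchUp hf hM hC hP hx₀ hr
  set h : ℕ → ℝ := fun N => 1 / ((N : ℝ) + 1) with hh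
  have hpos : ∀ N, 0 < h N := fun N => Nat.one_div_pos_of_nat
  set k : ℝ → ℕ → ℕ := fun t N => ⌊t / h N⌋₊ with hk
  have hk_le : ∀ t, 0 ≤ t → ∀ N, k t N * h N ≤ t := fun t ht N =>
    (le_div_iff₀ (hpos N)).1 (Nat.floor_le (div_nonneg ht (hpos N).le))
  have hk_lt : ∀ t N, t < (k t N + 1) * h N := fun t N =>
    (div_lt_iff₀ (hpos N)).1 (Nat.lt_floor_add_one _)
  have hk_mono : ∀ s t, s ≤ t → ∀ N, k s N ≤ k t N := fun s t hst N =>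
    Nat.floor_mono (div_le_div_of_nonneg_right hst (hpos N).le)
  set X : ℝ → ℕ → E := fun t N => catchUp f P x₀ (h N) (k t N) with hX
  set l : Filter ℕ := (hyperfilter ℕ : Filter ℕ) with hl
  have hh0 : Tendsto h l (𝓝 0) :=
    tendsto_one_div_add_atTop_nhds_zero_nat.mono_left Nat.hyperfilter_le_atTop
  have hk_lim : ∀ t, 0 ≤ t → Tendsto (fun N => k t N * h N) l (𝓝 t) := fun t ht => by
    refine tendsto_of_tendsto_of_tendsto_of_le_of_le (g := fun N => t - h N) (h := fun _ => t) ?_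
      tendsto_const_nhds (fun N => ?_) (fun N => hk_le t ht N)
    · simpa using tendsto_const_nhds.sub hh0
    · have := hk_lt t N
      simp only
      linarith
  have hlim : ∀ t, ∃ x, t ∈ Icc 0 T → Tendsto (X t) l (𝓝 x) := fun t => by
    by_cases ht : t ∈ Icc 0 T
    · obtain ⟨x, -, hx⟩ := (isCompact_closedBall (0 : E) r).ultrafilter_le_nhds
        ((hyperfilter ℕ).map (X t)) (by
          rw [le_principal_iff]
          refine Filter.Eventually.of_forall (f := l) fun N => ?_
          exact mem_closedBall_zero_iff.2
            (hr _ (hpos N) _ ((hk_le t ht.1 N).trans ht.2)))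
      exact ⟨x, fun _ => hx⟩
    · exact ⟨0, fun h => absurd h ht⟩
  choose x hx using hlim
  have hXlip : ∀ s ∈ Icc 0 T, ∀ t ∈ Icc 0 T, s ≤ t → ‖x t - x s‖ ≤ Λ * (t - s) := by
    intro s hs t ht hst
    refine le_of_tendsto_of_tendsto' ((hx t ht).sub (hx s hs)).norm
      (((hk_lim t ht.1).sub (hk_lim s hs.1)).const_mul Λ) fun N => ?_
    obtain ⟨j, hj⟩ := Nat.exists_eq_add_of_le (hk_mono s t hst N)
    have hb := hk_le t ht.1 N
    simp only [hX]
    rw [hj] at hb ⊢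
    refine (hlip _ (hpos N) _ _ (hb.trans ht.2)).trans (le_of_eq ?_)
    push_cast; ring
  refine ⟨x, Λ, hΛ, fun s hs t ht => ?_, ?_, fun t ht => ?_, fun y => ?_⟩
  · rcases le_total s t with hst | hst
    · rw [abs_of_nonneg (sub_nonneg.2 hst)]
      exact hXlip s hs t ht hst
    · rw [norm_sub_rev, abs_sub_comm, abs_of_nonneg (sub_nonneg.2 hst)]
      exact hXlip t ht s hs hst
  · refine tendsto_nhds_unique (hx 0 ⟨le_rfl, hT⟩) ?_
    simp [hX, hk, catchUp]
  · obtain ⟨κ, -, hκ⟩ := hC.lipschitz r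
    have : ∀ N, ∃ y ∈ C t, ‖X t N - y‖ ≤ κ * |t - k t N * h N| := fun N =>
      hκ _ _ _ (catchUp_mem (fun t v => (hP t v).1) hx₀ _ _)
        (hr _ (hpos N) _ ((hk_le t ht.1 N).trans ht.2))
    choose y hyC hy using this
    have h0 : Tendsto (fun N => X t N - y N) l (𝓝 0) := by
      refine squeeze_zero_norm hy ?_
      simpa using ((tendsto_const_nhds (x := t)).sub (hk_lim t ht.1)).abs.const_mul κ
    have h1 : Tendsto y l (𝓝 (x t)) := by simpa using (hx t ht).sub h0
    exact (hC.isClosed t).mem_of_tendsto h1 (Eventually.of_forall hyC)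
  · refine ⟨(M * (1 + r)) ^ 2 + 2 * L * Λ * (r + ‖y‖) + 2 * (M * (1 + r)) * Λ,
      fun p hp q hq hpq hy => ?_⟩
    have hxp := hx p hp
    have hxq := hx q hq
    have hkp := hk_lim p hp.1
    have hkq := hk_lim q hq.1
    refine le_of_tendsto_of_tendsto' ((hxq.sub tendsto_const_nhds).norm.pow 2)
      ((((hxp.sub tendsto_const_nhds).norm.pow 2).add
        (((hf.tendsto_integral hxp hkp hkq).inner
          (hxp.sub tendsto_const_nhds)).const_mul 2)).add
        (((hkq.sub hkp).pow 2).const_mul _)) fun N => ?_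
    obtain ⟨j, hj⟩ := Nat.exists_eq_add_of_le (hk_mono p q hpq N)
    have hb := hk_le q hq.1 N
    simp only [hX]
    rw [hj] at hb ⊢
    have := catchUp_evi hf hL hM hP (hpos N) hΛ (hr _ (hpos N)) (hlip _ (hpos N)) y (k p N) j
      (hb.trans hq.2) fun i h1 h2 => hy _ ⟨?_, ?_⟩
    · refine this.trans (le_of_eq ?_)
      push_cast; ring
    · refine (hk_lt p N).le.trans ?_
      have : (k p N + 1 : ℝ) ≤ i := by exact_mod_cast h1
      have := (hpos N).le
      gcongr
    · refine le_trans ?_ hb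
      have := (hpos N).le
      gcongr

theorem HasDerivAt.nonneg_of_eventually_nonneg_right {ψ : ℝ → ℝ} {c t : ℝ}
    (h : HasDerivAt ψ c t) (h0 : ψ t = 0) (hψ : ∀ᶠ s in 𝓝[>] t, 0 ≤ ψ s) : 0 ≤ c := by
  have h1 : Tendsto (slope ψ t) (𝓝[>] t) (𝓝 c) :=
    (hasDerivWithinAt_iff_tendsto_slope' self_notMem_Ioi).1 h.hasDerivWithinAt
  refine ge_of_tendsto h1 ?_
  filter_upwards [hψ, self_mem_nhdsWithin] with s hs hts
  rw [slope_def_field, h0, sub_zero]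
  exact div_nonneg hs (sub_nonneg.2 (le_of_lt hts))

theorem inner_sub_nonpos_of_evi (hf : IsLipschitzCaratheodory f L M) (hL : 0 ≤ L)
    {X : ℝ → E} {K : NNReal} (hX : LipschitzWith K X) {T t : ℝ} (ht : t < T) {y v : E} {D : ℝ}
    (hevi : ∀ q ∈ Ioc t T, (∀ s ∈ Icc t q, y ∈ C s) →
      ‖X q - y‖ ^ 2 ≤ ‖X t - y‖ ^ 2 + 2 * ⟪∫ s in t..q, f (X t) s, X t - y⟫ + D * (q - t) ^ 2)
    (hy : ∀ᶠ s in 𝓝 t, y ∈ C s) (hinteg : ∀ p q, IntervalIntegrable (fun s => f (X s) s) volume p q)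
    (hv : HasDerivAt X v t)
    (hG : HasDerivAt (fun q => ∫ s in t..q, f (X s) s) (f (X t) t) t) :
    ⟪f (X t) t - v, y - X t⟫ ≤ 0 := by
  set D' := D + 2 * (L * K * ‖X t - y‖) with hD'
  set ψ : ℝ → ℝ := fun q => ‖X t - y‖ ^ 2 + 2 * ⟪∫ s in t..q, f (X s) s, X t - y⟫ +
    D' * (q - t) ^ 2 - ‖X q - y‖ ^ 2 with hψ
  have hder : HasDerivAt ψ (2 * ⟪f (X t) t, X t - y⟫ - 2 * ⟪X t - y, v⟫) t := by
    have h1 := (hG.inner ℝ (hasDerivAt_const t (X t - y))).const_mul 2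
    have h2 := (((hasDerivAt_id t).sub_const t).pow 2).const_mul D'
    have h3 := (hv.sub_const y).norm_sq
    have := (((hasDerivAt_const t (‖X t - y‖ ^ 2)).add h1).add h2).sub h3
    exact this.congr_deriv (by simp)
  have h0 : ψ t = 0 := by simp [hψ]
  have hpos : ∀ᶠ q in 𝓝[>] t, 0 ≤ ψ q := by
    obtain ⟨ε, hε, hball⟩ := Metric.eventually_nhds_iff.1 hy
    have hmem : Ioo t (min T (t + ε)) ∈ 𝓝[>] t :=
      Ioo_mem_nhdsGT (lt_min ht (by linarith))
    filter_upwards [hmem] with q hq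
    have hqT := hq.2.trans_le (min_le_left _ _)
    have hqε := hq.2.trans_le (min_le_right _ _)
    have hE := hevi q ⟨hq.1, hqT.le⟩ fun s hs => hball (by
      rw [Real.dist_eq, abs_of_nonneg (sub_nonneg.2 hs.1)]; linarith [hs.2])
    have hqt : 0 ≤ q - t := by linarith [hq.1]
    have hdiff : ‖(∫ s in t..q, f (X t) s) - ∫ s in t..q, f (X s) s‖ ≤
        L * (K * (q - t)) * (q - t) := by
      rw [← intervalIntegral.integral_sub (hf.intervalIntegrable _ _ _) (hinteg _ _)]
      refine (intervalIntegral.norm_integral_le_of_norm_le_const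
        (C := L * (K * (q - t))) fun s hs => ?_).trans (by rw [abs_of_nonneg hqt])
      rw [uIoc_of_le hq.1.le] at hs
      refine (hf.lipschitz _ _ _).trans ?_
      have := hX.norm_sub_le t s
      rw [Real.norm_eq_abs, abs_sub_comm, abs_of_nonneg (by linarith [hs.1])] at this
      have h2 : (K : ℝ) * (s - t) ≤ K * (q - t) := by gcongr; exact hs.2
      gcongr
      linarith
    have hin : ⟪(∫ s in t..q, f (X t) s) - ∫ s in t..q, f (X s) s, X t - y⟫ ≤
        L * (K * (q - t)) * (q - t) * ‖X t - y‖ :=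
      (real_inner_le_norm _ _).trans (by gcongr)
    rw [inner_sub_left] at hin
    simp only [hψ, hD']
    nlinarith
  have := hder.nonneg_of_eventually_nonneg_right h0 hpos
  rw [real_inner_comm v] at this
  have h4 : ⟪f (X t) t - v, y - X t⟫ = -(⟪f (X t) t, X t - y⟫ - ⟪v, X t - y⟫) := by
    rw [← neg_sub (X t) y, inner_neg_right, inner_sub_left]
  linarith

theorem exists_sweeping_solution (hf : IsLipschitzCaratheodory f L M) (hL : 0 ≤ L) (hM : 0 ≤ M)
    (hC : IsMovingConvexSet C) (hCdense : ∀ t, C t ⊆ closure {y | ∀ᶠ s in 𝓝 t, y ∈ C s})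
    (hx₀ : x₀ ∈ C 0) {T : ℝ} (hT : 0 ≤ T) :
    ∃ x x' : ℝ → E, IsW12On T x x' ∧ x 0 = x₀ ∧
      ∀ᵐ t ∂(volume.restrict (Icc (0 : ℝ) T)),
        ∃ w ∈ normalCone (C t) (x t), x' t = -w + f (x t) t := by
  obtain ⟨x, Λ, hΛ, hxlip, hx0, hxC, hevi⟩ := exists_evi_solution hf hL hM hC hx₀ hT
  set X : ℝ → E := fun t => x (projIcc 0 T hT t) with hXdef
  have hXx : ∀ t ∈ Icc 0 T, X t = x t := fun t ht => by simp [hXdef, projIcc_of_mem hT ht]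
  have hX : LipschitzWith Λ.toNNReal X := LipschitzWith.of_dist_le_mul fun s t => by
    rw [dist_comm, dist_eq_norm, Real.coe_toNNReal _ hΛ, dist_comm]
    refine (hxlip _ (projIcc 0 T hT s).2 _ (projIcc 0 T hT t).2).trans ?_
    have := (LipschitzWith.projIcc hT).dist_le_mul t s
    rw [Subtype.dist_eq, Real.dist_eq] at this
    gcongr
    simpa using this
  have hGmeas : Measurable fun s => f (X s) s :=
    (measurable_uncurry_of_continuous_of_measurable (u := f)
      (fun s => (LipschitzWith.of_dist_le_mul (K := L.toNNReal) fun x y => by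
        simpa [dist_eq_norm, hL] using hf.lipschitz x y s).continuous) hf.measurable).comp
      (hX.continuous.measurable.prodMk measurable_id)
  obtain ⟨R, hR⟩ : ∃ R, ∀ s, ‖X s‖ ≤ R := by
    refine ⟨‖x₀‖ + Λ * T, fun s => ?_⟩
    have h1 := hxlip 0 ⟨le_rfl, hT⟩ _ (projIcc 0 T hT s).2
    have h2 := (projIcc 0 T hT s).2
    rw [sub_zero, abs_of_nonneg h2.1, hx0] at h1
    have h3 : Λ * (projIcc 0 T hT s : ℝ) ≤ Λ * T := by gcongr; exact h2.2
    have h4 := norm_le_norm_add_norm_sub' (X s) x₀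
    linarith
  have hGint : LocallyIntegrable (fun s => f (X s) s) volume :=
    (locallyIntegrable_const (M * (1 + R))).mono hGmeas.aestronglyMeasurable
      (Eventually.of_forall fun s => (hf.growth _ _).trans
        (le_trans (by gcongr; exact hR s) (le_abs_self _)))
  have hGii : ∀ p q, IntervalIntegrable (fun s => f (X s) s) volume p q := fun p q =>
    intervalIntegrable_iff.2
      ((hGint.integrableOn_isCompact isCompact_uIcc).mono_set uIoc_subset_uIcc)
  refine ⟨X, deriv X, ⟨?_, fun t _ => hX.eq_add_integral_deriv t⟩,
    (hXx 0 ⟨le_rfl, hT⟩).trans hx0, ?_⟩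
  · exact MemLp.of_bound (stronglyMeasurable_deriv X).aestronglyMeasurable Λ.toNNReal
      (Eventually.of_forall fun s => norm_deriv_le_of_lipschitz hX)
  · rw [← restrict_Ioo_eq_restrict_Icc, ae_restrict_iff' measurableSet_Ioo]
    filter_upwards [hX.ae_differentiableAt_real,
      LocallyIntegrable.ae_hasDerivAt_integral hGint] with t hd hI ht
    have htI := Ioo_subset_Icc_self ht
    refine ⟨f (X t) t - deriv X t, ⟨by rw [hXx t htI]; exact hxC t htI, fun y hy => ?_⟩, by abel⟩
    have hclosed : IsClosed {y | ⟪f (X t) t - deriv X t, y - X t⟫ ≤ 0} :=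
      isClosed_le (by fun_prop) continuous_const
    refine closure_minimal (fun y hy => ?_) hclosed (hCdense t hy)
    obtain ⟨D, hD⟩ := hevi y
    refine inner_sub_nonpos_of_evi hf hL hX (D := D) ht.2 (fun q hq hyq => ?_) hy hGii
      hd.hasDerivAt (hI t)
    have hqI : q ∈ Icc 0 T := ⟨ht.1.le.trans hq.1.le, hq.2⟩
    rw [hXx t htI, hXx q hqI]
    exact hD t htI q hqI hq.1.le hyq

end SweepingProcess

section Polyhedron

variable {n m : ℕ} {a : ℝ → Fin m → En n} {b : ℝ → Fin m → ℝ}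

theorem convex_polyhedron (a : Fin m → En n) (b : Fin m → ℝ) : Convex ℝ (polyhedron a b) := by
  rw [polyhedron, ofPred_forall]
  exact convex_iInter fun i => convex_halfSpace_le (innerₛₗ ℝ (a i)).isLinear _

theorem isClosed_polyhedron (a : Fin m → En n) (b : Fin m → ℝ) : IsClosed (polyhedron a b) := by
  rw [polyhedron, ofPred_forall]
  exact isClosed_iInter fun i => isClosed_le (by fun_prop) continuous_const

/-- Moving a point of a polyhedron towards a Slater point of a nearby polyhedron yields a nearby
point of the latter. -/
theorem exists_mem_polyhedron_near {a₁ a₂ : Fin m → En n} {b₁ b₂ : Fin m → ℝ} {δ c r R : ℝ}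
    {x z : En n} (ha : ∀ i, ‖a₂ i - a₁ i‖ ≤ δ) (hb : ∀ i, |b₂ i - b₁ i| ≤ δ) (hδ : 0 ≤ δ)
    (hc : c < 0) (hz : ∀ i, ⟪a₂ i, z⟫ - b₂ i ≤ c) (hx : x ∈ polyhedron a₁ b₁) (hxr : ‖x‖ ≤ r)
    (hzR : ‖z‖ ≤ R) :
    ∃ y ∈ polyhedron a₂ b₂, ‖x - y‖ ≤ (1 + r) * (R + r) / (-c) * δ := by
  have hr : 0 ≤ r := (norm_nonneg _).trans hxr
  have hR : 0 ≤ R := (norm_nonneg _).trans hzR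
  set μ := δ * (1 + r) with hμ
  have hμ0 : 0 ≤ μ := by positivity
  have hμc : 0 < μ - c := by linarith
  set l := μ / (μ - c) with hl
  have hl0 : 0 ≤ l := by positivity
  have hl1 : l ≤ 1 := (div_le_one hμc).2 (by linarith)
  have hlμ : l * (μ - c) = μ := div_mul_cancel₀ _ hμc.ne'
  refine ⟨x + l • (z - x), fun i => ?_, ?_⟩
  · have h1 : ⟪a₂ i, x⟫ ≤ b₂ i + μ := by
      have h2 : ⟪a₂ i, x⟫ = ⟪a₁ i, x⟫ + ⟪a₂ i - a₁ i, x⟫ := by rw [inner_sub_left]; ring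
      have h3 : ⟪a₂ i - a₁ i, x⟫ ≤ δ * r :=
        (real_inner_le_norm _ _).trans (mul_le_mul (ha i) hxr (norm_nonneg _) hδ)
      have h4 := hx i
      have h5 := (abs_le.1 (hb i)).1
      rw [hμ]; linarith
    have h2 := hz i
    rw [inner_add_right, inner_smul_right, inner_sub_right]
    have h3 := mul_le_mul_of_nonneg_left h1 (sub_nonneg.2 hl1)
    have h4 := mul_le_mul_of_nonneg_left h2 hl0
    linarith
  · have h1 : l ≤ μ / (-c) := by
      rw [hl]; gcongr
      · linarith
      · linarith
    have h2 : ‖z - x‖ ≤ R + r := (norm_sub_le _ _).trans (by gcongr)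
    have h3 : x - (x + l • (z - x)) = -(l • (z - x)) := by abel
    rw [h3, norm_neg, norm_smul, Real.norm_of_nonneg hl0]
    calc l * ‖z - x‖ ≤ μ / (-c) * (R + r) := by
          gcongr
          exact div_nonneg hμ0 (by linarith)
      _ = _ := by rw [hμ]; ring

theorem isMovingConvexSet_polyhedron {K c R ρ : ℝ} {z : ℝ → En n} (hK : 0 ≤ K)
    (ha : ∀ s t i, ‖a t i - a s i‖ ≤ K * |t - s|) (hb : ∀ s t i, |b t i - b s i| ≤ K * |t - s|)
    (hc : c < 0) (hz : ∀ t i, ⟪a t i, z t⟫ - b t i ≤ c) (hzR : ∀ t, ‖z t‖ ≤ R)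
    (hzρ : ∀ s t, ‖z t - z s‖ ≤ ρ * |t - s|) :
    IsMovingConvexSet fun t => polyhedron (a t) (b t) where
  convex t := convex_polyhedron _ _
  isClosed t := isClosed_polyhedron _ _
  selection := ⟨z, R, ρ, fun t i => by linarith [hz t i], hzR, hzρ⟩
  lipschitz r := by
    have hR : 0 ≤ R := (norm_nonneg _).trans (hzR 0)
    refine ⟨(1 + |r|) * (R + |r|) / (-c) * K, ?_, fun s t x hx hxr => ?_⟩
    · have : 0 < -c := by linarith
      positivity
    · obtain ⟨y, hy, hxy⟩ := exists_mem_polyhedron_near (ha s t) (hb s t) (by positivity) hc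
        (hz t) hx (hxr.trans (le_abs_self r)) (hzR t)
      exact ⟨y, hy, hxy.trans (by rw [mul_assoc])⟩

theorem polyhedron_subset_closure_eventually_mem (ha : Continuous a) (hb : Continuous b) {t : ℝ}
    {z : En n} (hz : ∀ i, ⟪a t i, z⟫ < b t i) :
    polyhedron (a t) (b t) ⊆ closure {y | ∀ᶠ s in 𝓝 t, y ∈ polyhedron (a s) (b s)} := by
  intro x hx
  have hlim : Tendsto (fun ε : ℝ => x + ε • (z - x)) (𝓝[>] 0) (𝓝 x) := by
    have : Continuous fun ε : ℝ => x + ε • (z - x) := by fun_prop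
    exact (this.tendsto' 0 x (by simp)).mono_left nhdsWithin_le_nhds
  refine mem_closure_of_tendsto hlim ?_
  filter_upwards [Ioo_mem_nhdsGT (zero_lt_one (α := ℝ))] with ε hε
  have hstrict : ∀ i, ⟪a t i, x + ε • (z - x)⟫ < b t i := fun i => by
    rw [inner_add_right, inner_smul_right, inner_sub_right]
    have h1 := mul_le_mul_of_nonneg_left (hx i) (sub_nonneg.2 hε.2.le)
    have h2 := mul_lt_mul_of_pos_left (hz i) hε.1
    linarith
  refine eventually_all.2 fun i => ?_
  have hl : Continuous fun s => ⟪a s i, x + ε • (z - x)⟫ := by fun_prop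
  have hr : Continuous fun s => b s i := by fun_prop
  filter_upwards [hl.continuousAt.eventually_lt hr.continuousAt (hstrict i)] with s hs using hs.le

open scoped Manifold ContDiff in
theorem exists_contDiff_slater (ha : Continuous a) (hb : Continuous b) {c : ℝ}
    (h : ∀ t, ∃ z, ∀ i, ⟪a t i, z⟫ - b t i < c) :
    ∃ z : ℝ → En n, ContDiff ℝ 1 z ∧ ∀ t i, ⟪a t i, z t⟫ - b t i < c := by
  have hconv : ∀ t, Convex ℝ {z : En n | ∀ i, ⟪a t i, z⟫ - b t i < c} := fun t => by
    rw [ofPred_forall]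
    refine convex_iInter fun i => ?_
    simp only [sub_lt_iff_lt_add]
    exact convex_halfSpace_lt (innerₛₗ ℝ (a t i)).isLinear _
  obtain ⟨z, hz⟩ := exists_contMDiffMap_forall_mem_convex_of_local_const (n := 1) 𝓘(ℝ, ℝ) hconv
    fun t => by
      obtain ⟨z, hz⟩ := h t
      refine ⟨z, eventually_all.2 fun i => ?_⟩
      have hl : Continuous fun s => ⟪a s i, z⟫ - b s i := by fun_prop
      exact hl.continuousAt.eventually_lt continuousAt_const (hz i)
  exact ⟨z, z.contMDiff.contDiff, hz⟩

end Polyhedron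

theorem IsW12On.norm_sub_le {E : Type*} [NormedAddCommGroup E] [NormedSpace ℝ E] [CompleteSpace E]
    {T : ℝ} {f f' : ℝ → E} (hf : IsW12On T f f') {K : ℝ}
    (hK : ∀ᵐ t ∂(volume.restrict (Icc (0 : ℝ) T)), ‖f' t‖ ≤ K) {s t : ℝ} (hs : s ∈ Icc 0 T)
    (ht : t ∈ Icc 0 T) : ‖f t - f s‖ ≤ K * |t - s| := by
  have hinteg : IntegrableOn f' (Icc 0 T) := hf.1.integrable one_le_two
  have hii : ∀ t ∈ Icc (0 : ℝ) T, IntervalIntegrable f' volume 0 t := fun t ht =>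
    (intervalIntegrable_iff_integrableOn_Icc_of_le ht.1).2
      (hinteg.mono_set (Icc_subset_Icc_right ht.2))
  rw [hf.2 t ht, hf.2 s hs, add_sub_add_left_eq_sub,
    intervalIntegral.integral_interval_sub_left (hii t ht) (hii s hs)]
  refine intervalIntegral.norm_integral_le_of_norm_le_const_ae ?_
  filter_upwards [(ae_restrict_iff' measurableSet_Icc).1 hK] with σ h hσ
  exact h (uIcc_subset_Icc hs ht (uIoc_subset_uIcc hσ))

theorem AbsolutelyContinuousOnInterval.fun_sum {ι F : Type*} [NormedAddCommGroup F]
    {p q : ℝ} (s : Finset ι) {f : ι → ℝ → F}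
    (hf : ∀ i ∈ s, AbsolutelyContinuousOnInterval (f i) p q) :
    AbsolutelyContinuousOnInterval (fun t => ∑ i ∈ s, f i t) p q := by
  classical
  induction s using Finset.induction_on with
  | empty =>
    simpa using (LipschitzWith.const (0 : F)).lipschitzOnWith.absolutelyContinuousOnInterval
  | insert i s hi ih =>
    simp only [Finset.sum_insert hi]
    exact (hf i (by simp)).fun_add (ih fun j hj => hf j (by simp [hj]))

/-- Grönwall's inequality in differential form for absolutely continuous curves starting at `0`. -/
theorem IsW12On.eq_zero_of_inner_deriv_le {n : ℕ} {T L : ℝ} {D D' : ℝ → En n}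
    (hD : IsW12On T D D') (h0 : D 0 = 0)
    (hle : ∀ᵐ t ∂(volume.restrict (Icc (0 : ℝ) T)), ⟪D' t, D t⟫ ≤ L * ‖D t‖ ^ 2) {t : ℝ}
    (ht : t ∈ Icc 0 T) : D t = 0 := by
  have hinteg : IntegrableOn D' (Icc 0 T) := hD.1.integrable one_le_two
  have hii : IntervalIntegrable D' volume 0 t :=
    (intervalIntegrable_iff_integrableOn_Icc_of_le ht.1).2
      (hinteg.mono_set (Icc_subset_Icc_right ht.2))
  have hiii : ∀ i, IntervalIntegrable (fun s => D' s i) volume 0 t := fun i =>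
    ⟨(EuclideanSpace.proj (𝕜 := ℝ) i).integrable_comp hii.1,
      (EuclideanSpace.proj (𝕜 := ℝ) i).integrable_comp hii.2⟩
  set I : Fin n → ℝ → ℝ := fun i s => ∫ σ in (0 : ℝ)..s, D' σ i with hI
  have hDI : ∀ s ∈ Icc 0 t, ∀ i, D s i = I i s := fun s hs i => by
    rw [hD.2 s ⟨hs.1, hs.2.trans ht.2⟩, h0, zero_add]
    exact ((EuclideanSpace.proj (𝕜 := ℝ) i).intervalIntegral_comp_comm
      (hii.mono_set (by rw [uIcc_of_le hs.1, uIcc_of_le ht.1]; exact Icc_subset_Icc_right hs.2))).symm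
  set φ : ℝ → ℝ := fun s => Real.exp (-2 * L * s) * ∑ i, I i s * I i s with hφ
  have hac : AbsolutelyContinuousOnInterval φ 0 t := by
    refine AbsolutelyContinuousOnInterval.fun_mul ?_ (.fun_sum _ fun i _ => ?_)
    · exact ContDiffOn.absolutelyContinuousOnInterval (by fun_prop)
    · have := (hiii i).absolutelyContinuousOnInterval_intervalIntegral left_mem_uIcc
      exact this.fun_mul this
  have hder : ∀ᵐ s, s ∈ Icc 0 t → deriv φ s ≤ 0 := by
    have h1 : ∀ᵐ s, ∀ i, s ∈ uIcc 0 t → HasDerivAt (I i) (D' s i) s := by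
      refine eventually_all.2 fun i => ?_
      filter_upwards [(hiii i).ae_hasDerivAt_integral] with s hs hst
      exact hs hst 0 left_mem_uIcc
    filter_upwards [h1, (ae_restrict_iff' measurableSet_Icc).1 hle] with s h1 h2 hs
    have h2 := h2 ⟨hs.1, hs.2.trans ht.2⟩
    have hs' : s ∈ uIcc 0 t := by rwa [uIcc_of_le ht.1]
    have h3 : HasDerivAt φ _ s := (((hasDerivAt_id s).const_mul (-2 * L)).exp).mul
      (HasDerivAt.fun_sum fun i _ => (h1 i hs').mul (h1 i hs'))
    have h4 : ⟪D' s, D s⟫ = ∑ i, D' s i * I i s := by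
      simp only [PiLp.inner_apply, hDI s hs, RCLike.inner_apply, conj_trivial]
      exact Finset.sum_congr rfl fun i _ => mul_comm _ _
    have h5 : ‖D s‖ ^ 2 = ∑ i, I i s * I i s := by
      rw [EuclideanSpace.norm_sq_eq]
      exact Finset.sum_congr rfl fun i _ => by
        rw [hDI s hs, Real.norm_eq_abs, sq_abs, sq]
    have h6 : ∑ i, (D' s i * I i s + I i s * D' s i) = 2 * ∑ i, D' s i * I i s := by
      rw [Finset.mul_sum]; exact Finset.sum_congr rfl fun i _ => by ring
    rw [h3.deriv, h6, ← h4, ← h5]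
    simp only [id, mul_one]
    have := mul_nonneg (Real.exp_pos (-2 * L * s)).le (sub_nonneg.2 h2)
    linarith
  have hinteg := hac.integral_deriv_eq_sub
  have hnonpos : ∫ s in (0 : ℝ)..t, deriv φ s ≤ 0 := by
    rw [intervalIntegral.integral_of_le ht.1]
    refine integral_nonpos_of_ae ((ae_restrict_iff' measurableSet_Ioc).2 ?_)
    filter_upwards [hder] with s hs hst using hs (Ioc_subset_Icc_self hst)
  have hφ0 : φ 0 = 0 := by simp [hφ, hI]
  rw [hinteg, hφ0, sub_zero] at hnonpos
  have hsum : ∑ i, I i t * I i t = 0 := by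
    refine le_antisymm ?_ (Finset.sum_nonneg fun i _ => mul_self_nonneg _)
    exact nonpos_of_mul_nonpos_right hnonpos (Real.exp_pos _)
  ext i
  rw [hDI t ⟨ht.1, le_rfl⟩ i]
  simpa using (Finset.sum_eq_zero_iff_of_nonneg fun i _ => mul_self_nonneg _).1 hsum i

theorem IsW12On.sub {E : Type*} [NormedAddCommGroup E] [NormedSpace ℝ E] [CompleteSpace E]
    {T : ℝ} {f f' h h' : ℝ → E} (hf : IsW12On T f f') (hh : IsW12On T h h') :
    IsW12On T (fun t => f t - h t) (fun t => f' t - h' t) := by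
  refine ⟨hf.1.sub hh.1, fun t ht => ?_⟩
  have hii : ∀ {k : ℝ → E}, MemLp k 2 (volume.restrict (Icc (0 : ℝ) T)) →
      IntervalIntegrable k volume 0 t := fun {k} hk => by
    have hinteg : IntegrableOn k (Icc 0 T) := hk.integrable one_le_two
    exact (intervalIntegrable_iff_integrableOn_Icc_of_le ht.1).2
      (hinteg.mono_set (Icc_subset_Icc_right ht.2))
  beta_reduce
  rw [intervalIntegral.integral_sub (hii hf.1) (hii hh.1), hf.2 t ht, hh.2 t ht]
  abel

theorem inner_sub_sub_nonneg_of_mem_normalCone {E : Type*} [NormedAddCommGroup E]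
    [InnerProductSpace ℝ E] {C : Set E} {x y v w : E} (hv : v ∈ normalCone C x)
    (hw : w ∈ normalCone C y) : 0 ≤ ⟪w - v, y - x⟫ := by
  have h1 := hv.2 y hw.1
  have h2 := hw.2 x hv.1
  rw [← neg_sub y x, inner_neg_right] at h2
  rw [inner_sub_left]
  linarith

/-- Two trajectories of a sweeping process with a one-sided Lipschitz perturbation that start at the
same point coincide. -/
theorem eq_of_sweeping_solutions {n : ℕ} {T L : ℝ} {C : ℝ → Set (En n)} {F : ℝ → En n → En n}
    (hF : ∀ᵐ t ∂(volume.restrict (Icc (0 : ℝ) T)), ∀ x y, ‖F t y - F t x‖ ≤ L * ‖y - x‖)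
    {x x' y y' : ℝ → En n} (hx : IsW12On T x x') (hy : IsW12On T y y') (h0 : y 0 = x 0)
    (hx' : ∀ᵐ t ∂(volume.restrict (Icc (0 : ℝ) T)),
      ∃ w ∈ normalCone (C t) (x t), x' t = -w + F t (x t))
    (hy' : ∀ᵐ t ∂(volume.restrict (Icc (0 : ℝ) T)),
      ∃ w ∈ normalCone (C t) (y t), y' t = -w + F t (y t)) {t : ℝ} (ht : t ∈ Icc 0 T) :
    y t = x t := by
  refine sub_eq_zero.1 ((hy.sub hx).eq_zero_of_inner_deriv_le (L := L) (sub_eq_zero.2 h0) ?_ ht)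
  filter_upwards [hF, hx', hy'] with s hF hx hy
  obtain ⟨v, hv, hxv⟩ := hx
  obtain ⟨w, hw, hyw⟩ := hy
  have h1 : y' s - x' s = -(w - v) + (F s (y s) - F s (x s)) := by rw [hxv, hyw]; abel
  have h2 := inner_sub_sub_nonneg_of_mem_normalCone hv hw
  have h3 : ⟪F s (y s) - F s (x s), y s - x s⟫ ≤ L * ‖y s - x s‖ ^ 2 := by
    refine (real_inner_le_norm _ _).trans ?_
    rw [sq, ← mul_assoc]
    exact mul_le_mul_of_nonneg_right (hF _ _) (norm_nonneg _)
  rw [h1, inner_add_left, inner_neg_left]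
  linarith

/-- The dynamics driven by a fixed control, extended by zero where the control is not admissible,
is a Carathéodory field. -/
theorem isLipschitzCaratheodory_indicator {E V : Type*} [NormedAddCommGroup E] [MeasurableSpace E]
    [BorelSpace E] [NormedAddCommGroup V] [MeasurableSpace V] [BorelSpace V] {g : E → V → E}
    {U : Set V} (hU : IsClosed U) {L M : ℝ} (hL : 0 ≤ L) (hM : 0 ≤ M)
    (hLip : ∀ x₁ x₂, ∀ u₁ ∈ U, ∀ u₂ ∈ U, ‖g x₁ u₁ - g x₂ u₂‖ ≤ L * (‖x₁ - x₂‖ + ‖u₁ - u₂‖))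
    (hGrow : ∀ x, ∀ u ∈ U, ‖g x u‖ ≤ M * (1 + ‖x‖)) {u : ℝ → V} (hu : Measurable u) :
    IsLipschitzCaratheodory (fun x t => U.indicator (g x) (u t)) L M where
  measurable x := by
    have hcont : ContinuousOn (g x) U :=
      (LipschitzOnWith.of_dist_le_mul (K := L.toNNReal) fun u₁ h₁ u₂ h₂ => by
        simpa [dist_eq_norm, Real.coe_toNNReal L hL] using hLip x x u₁ h₁ u₂ h₂).continuousOn
    have hmeas : Measurable (U.indicator (g x)) := by
      classical
      rw [← piecewise_eq_indicator]
      exact hcont.measurable_piecewise continuousOn_const hU.measurableSet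
    exact hmeas.comp hu
  lipschitz x y t := by
    by_cases h : u t ∈ U
    · simpa [h] using hLip x y _ h _ h
    · simpa [h] using by positivity
  growth x t := by
    by_cases h : u t ∈ U
    · simpa [h] using hGrow x _ h
    · simpa [h] using by positivity

/-- A map that is continuously differentiable on `ℝ` becomes globally Lipschitz and bounded when its
argument is clamped to a compact interval. -/
theorem ContDiff.exists_lipschitz_bound_projIcc {E : Type*} [NormedAddCommGroup E]
    [NormedSpace ℝ E] {z : ℝ → E} (hz : ContDiff ℝ 1 z) {p q : ℝ} (hpq : p ≤ q) :
    ∃ R ρ : ℝ, (∀ t, ‖z (projIcc p q hpq t)‖ ≤ R) ∧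
      ∀ s t, ‖z (projIcc p q hpq t) - z (projIcc p q hpq s)‖ ≤ ρ * |t - s| := by
  obtain ⟨R, hR⟩ := isCompact_Icc.exists_bound_of_continuousOn (s := Icc p q)
    hz.continuous.continuousOn
  obtain ⟨ρ, hρ⟩ := hz.contDiffOn.exists_lipschitzOnWith one_ne_zero (convex_Icc p q) isCompact_Icc
  refine ⟨R, ρ, fun t => hR _ (projIcc p q hpq t).2, fun s t => ?_⟩
  have h1 := hρ.dist_le_mul _ (projIcc p q hpq t).2 _ (projIcc p q hpq s).2
  have h2 := (LipschitzWith.projIcc hpq).dist_le_mul t s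
  rw [NNReal.coe_one, one_mul] at h2
  rw [← dist_eq_norm, ← Real.dist_eq]
  exact h1.trans (mul_le_mul_of_nonneg_left h2 ρ.2)

theorem IsW12On.norm_sub_projIcc_le {E : Type*} [NormedAddCommGroup E] [NormedSpace ℝ E]
    [CompleteSpace E] {T : ℝ} (hT : 0 ≤ T) {f f' : ℝ → E} (hf : IsW12On T f f') {K : ℝ}
    (hK0 : 0 ≤ K) (hK : ∀ᵐ t ∂(volume.restrict (Icc (0 : ℝ) T)), ‖f' t‖ ≤ K) (s t : ℝ) :
    ‖f (projIcc 0 T hT t) - f (projIcc 0 T hT s)‖ ≤ K * |t - s| := by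
  have h := (LipschitzWith.projIcc hT).dist_le_mul t s
  rw [NNReal.coe_one, one_mul] at h
  rw [← Real.dist_eq]
  exact (hf.norm_sub_le hK (projIcc 0 T hT s).2 (projIcc 0 T hT t).2).trans
    (mul_le_mul_of_nonneg_left h hK0)

/-- Well-posedness (existence and uniqueness of a `W^{1,2}` solution) of the
controlled polyhedral sweeping process under the standing assumptions (H1)-(H4). -/
theorem sweeping_process_wellposedness {n m d : ℕ} (T : ℝ) (hT : 0 < T)
    (U : Set (En d)) (g : En n → En d → En n)
    (a a' : ℝ → Fin m → En n) (b b' : ℝ → Fin m → ℝ)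
    -- (H1): U is closed and bounded
    (hUclosed : IsClosed U) (hUbdd : Bornology.IsBounded U)
    -- the controls (a,b) are W^{1,2} on [0,T]
    (ha : IsW12On T a a') (hb : IsW12On T b b')
    -- (H2): uniformly bounded derivatives
    (hH2 : ∃ K : ℝ, ∀ᵐ t ∂(volume.restrict (Icc (0:ℝ) T)), ∀ i, ‖a' t i‖ ≤ K ∧ |b' t i| ≤ K)
    -- (H3): uniform Lipschitz continuity and sublinear growth of g
    (hLip : ∃ L > (0:ℝ), ∀ (x₁ x₂ : En n), ∀ u₁ ∈ U, ∀ u₂ ∈ U,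
      ‖g x₁ u₁ - g x₂ u₂‖ ≤ L * (‖x₁ - x₂‖ + ‖u₁ - u₂‖))
    (hGrow : ∃ M > (0:ℝ), ∀ (x : En n), ∀ u ∈ U, ‖g x u‖ ≤ M * (1 + ‖x‖))
    -- (H4): absolutely continuous moduli for a and the uniform Slater condition
    (hH4a : ∀ i, ∃ v v' : ℝ → ℝ, IsW12On T v v' ∧
      ∀ s ∈ Icc (0:ℝ) T, ∀ t ∈ Icc (0:ℝ) T, ‖a t i - a s i‖ ≤ |v t - v s|)
    (hH4b : ∃ ϑ : ℝ → ℝ, ContinuousOn ϑ (Icc (0:ℝ) T) ∧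
      (∃ c < (0:ℝ), ∀ t ∈ Icc (0:ℝ) T, ϑ t ≤ c) ∧
      ∀ t ∈ Icc (0:ℝ) T, ∃ xs : En n, ∀ i, ⟪a t i, xs⟫ - b t i < ϑ t)
    -- the measurable L² control u with values in U
    (u : ℝ → En d) (hu : MemLp u 2 (volume.restrict (Icc (0:ℝ) T)))
    (huU : ∀ᵐ t ∂(volume.restrict (Icc (0:ℝ) T)), u t ∈ U)
    -- initial point
    (x₀ : En n) (hx₀ : x₀ ∈ polyhedron (a 0) (b 0)) :
    ∃ x x' : ℝ → En n,
      (IsW12On T x x' ∧ x 0 = x₀ ∧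
        ∀ᵐ t ∂(volume.restrict (Icc (0:ℝ) T)),
          ∃ w ∈ normalCone (polyhedron (a t) (b t)) (x t), x' t = -w + g (x t) (u t)) ∧
      ∀ y y' : ℝ → En n,
        (IsW12On T y y' ∧ y 0 = x₀ ∧
          ∀ᵐ t ∂(volume.restrict (Icc (0:ℝ) T)),
            ∃ w ∈ normalCone (polyhedron (a t) (b t)) (y t), y' t = -w + g (y t) (u t)) →
        ∀ t ∈ Icc (0:ℝ) T, y t = x t := by
  obtain ⟨K₀, hK₀⟩ := hH2
  obtain ⟨L, hL, hLip⟩ := hLip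
  obtain ⟨M, hM, hGrow⟩ := hGrow
  obtain ⟨ϑ, -, ⟨c, hc, hϑ⟩, hslater⟩ := hH4b
  set K := max K₀ 0 with hK
  have hK0 : 0 ≤ K := le_max_right _ _
  set P := projIcc 0 T hT.le with hP
  have hPmem : ∀ t ∈ Icc 0 T, (P t : ℝ) = t := fun t ht => by rw [hP, projIcc_of_mem hT.le ht]
  have haK := ha.norm_sub_projIcc_le hT.le hK0 <| by
    filter_upwards [hK₀] with t ht
    exact (pi_norm_le_iff_of_nonneg hK0).2 fun i => (ht i).1.trans (le_max_left _ _)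
  have hbK := hb.norm_sub_projIcc_le hT.le hK0 <| by
    filter_upwards [hK₀] with t ht
    exact (pi_norm_le_iff_of_nonneg hK0).2 fun i => (ht i).2.trans (le_max_left _ _)
  have hac : Continuous fun t => a (P t) := (LipschitzWith.of_dist_le_mul (K := K.toNNReal)
    fun s t => by
      rw [dist_eq_norm, Real.coe_toNNReal K hK0, Real.dist_eq]; exact haK t s).continuous
  have hbc : Continuous fun t => b (P t) := (LipschitzWith.of_dist_le_mul (K := K.toNNReal)
    fun s t => by
      rw [dist_eq_norm, Real.coe_toNNReal K hK0, Real.dist_eq]; exact hbK t s).continuous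
  obtain ⟨z, hz, hzc⟩ := exists_contDiff_slater hac hbc (c := c) fun t => by
    obtain ⟨y, hy⟩ := hslater (P t) (P t).2
    exact ⟨y, fun i => (hy i).trans_le (hϑ _ (P t).2)⟩
  have hzP : ∀ t i, ⟪a (P t) i, z (P t)⟫ - b (P t) i < c := fun t i => by
    simpa only [hPmem _ (P t).2] using hzc (P t) i
  obtain ⟨R, ρ, hzR, hzρ⟩ := hz.exists_lipschitz_bound_projIcc hT.le
  have hC : IsMovingConvexSet fun t => polyhedron (a (P t)) (b (P t)) :=
    isMovingConvexSet_polyhedron hK0 (fun s t i => (norm_le_pi_norm (a (P t) - a (P s)) i).trans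
      (haK s t)) (fun s t i => (norm_le_pi_norm (b (P t) - b (P s)) i).trans (hbK s t)) hc
      (fun t i => (hzP t i).le) hzR hzρ
  have hf := isLipschitzCaratheodory_indicator hUclosed hL.le hM.le hLip hGrow
    hu.1.stronglyMeasurable_mk.measurable
  obtain ⟨x, x', hx, hx0, hxN⟩ := exists_sweeping_solution hf hL.le hM.le hC
    (fun t => polyhedron_subset_closure_eventually_mem hac hbc fun i => by linarith [hzP t i])
    (x₀ := x₀) (by simpa only [hPmem 0 ⟨le_rfl, hT.le⟩] using hx₀) hT.le
  have hxN' : ∀ᵐ t ∂(volume.restrict (Icc (0 : ℝ) T)),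
      ∃ w ∈ normalCone (polyhedron (a t) (b t)) (x t), x' t = -w + g (x t) (u t) := by
    filter_upwards [hxN, huU, hu.1.ae_eq_mk, ae_restrict_mem measurableSet_Icc] with t h hU hut ht
    rwa [hPmem t ht, ← hut, indicator_of_mem hU] at h
  refine ⟨x, x', ⟨hx, hx0, hxN'⟩, fun y y' ⟨hy, hy0, hyN⟩ t ht => ?_⟩
  refine eq_of_sweeping_solutions (F := fun t x => g x (u t)) (L := L) ?_ hx hy (hy0.trans hx0.symm)
    hxN' hyN ht
  filter_upwards [huU] with s hs x y
  simpa using hLip y x _ hs _ hs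
end
end

section
/- Strong discrete approximation of feasible sweeping solutions: Assume (H1)–(H4) and let (x̄,ā,b̄,ū) be a feasible solution to the sweeping control system (x̄ ∈ W^{1,2}, ā ∈ W^{1,2} with ‖ā_i(t)‖ = 1, b̄ ∈ W^{1,2}, ū ∈ L² with ū(t) ∈ U a.e., x̄(0) = x₀ ∈ C(ā(0),b̄(0)), and ẋ̄(t) ∈ −N(x̄(t);C(ā(t),b̄(t))) + g(x̄(t),ū(t)) a.e.) such that the functions ẋ̄, ǡ, ḃ̄ and ū are of bounded variation on [0,T], with all variations bounded by a constant K. Then there exist partitions Δ_k = {0 = t₀^k < t₁^k < … < t_{ν(k)}^k = T}, k ∈ ℕ, with ν(k) ≥ k and stepsizes h_j^k := t_{j+1}^k − t_j^k ≤ ν̃/ν(k) for some constant ν̃ > 0, piecewise linear functions (x^k, a^k, b^k) and piecewise constant functions u^k on [0,T], and numbers δ_k ↓ 0, such that: (x^k(0), a^k(0), b^k(0)) = (x₀, ā(0), b̄(0)); 1 − δ_k ≤ ‖a_i^k(t_j^k)‖ ≤ 1 + δ_k for all mesh points t_j^k and all i = 1,…,m; x^k(t) = x^k(t_j^k) + (t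 − t_j^k)v_j^k for t ∈ [t_j^k, t_{j+1}^k] with −v_j^k ∈ F(x^k(t_j^k), a^k(t_j^k), b^k(t_j^k), u^k(t_j^k)) for j = 0,…,ν(k)−1; and, as k → ∞, (x^k, a^k, b^k) → (x̄, ā, b̄) in the W^{1,2}-norm on [0,T] (uniform convergence of the functions together with L²-convergence of their derivatives) and u^k → ū in the L²-norm on [0,T]. -/
open MeasureTheory Set Filter
open scoped RealInnerProductSpace Topology

noncomputable section

section Mesh

/-- A mesh `0 = τ 0 < ⋯ < τ N = T` with stepsizes at most `C / N`, extended to a strictly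
increasing sequence on `ℕ`. -/
structure IsMesh (T C : ℝ) (N : ℕ) (τ : ℕ → ℝ) : Prop where
  strictMono : StrictMono τ
  zero : τ 0 = 0
  last : τ N = T
  step_le : ∀ j < N, τ (j + 1) - τ j ≤ C / N

/-- The index of the mesh interval containing `t`. -/
def stepIndex (τ : ℕ → ℝ) (N : ℕ) (t : ℝ) : ℕ := Nat.findGreatest (fun j => τ j ≤ t) N

/-- The slope of the sequence `y` on the `j`-th mesh interval. -/
def stepSlope {E : Type*} [AddCommGroup E] [Module ℝ E] (τ : ℕ → ℝ) (y : ℕ → E) (j : ℕ) : E :=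
  (τ (j + 1) - τ j)⁻¹ • (y (j + 1) - y j)

/-- The piecewise linear interpolation of the values `y` at the mesh points `τ`. -/
def linInterp {E : Type*} [AddCommGroup E] [Module ℝ E] (τ : ℕ → ℝ) (N : ℕ) (y : ℕ → E)
    (t : ℝ) : E :=
  y (stepIndex τ N t) + (t - τ (stepIndex τ N t)) • stepSlope τ y (stepIndex τ N t)

theorem stepIndex_eq {τ : ℕ → ℝ} (hτ : StrictMono τ) {N j : ℕ} (hj : j ≤ N) {t : ℝ}
    (h₁ : τ j ≤ t) (h₂ : t < τ (j + 1)) : stepIndex τ N t = j := by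
  refine le_antisymm ?_ (Nat.le_findGreatest hj h₁)
  have h : τ (stepIndex τ N t) ≤ t :=
    Nat.findGreatest_spec (P := fun j => τ j ≤ t) hj h₁
  exact Nat.lt_succ_iff.1 (hτ.lt_iff_lt.1 (h.trans_lt h₂))

section LinInterp

variable {E : Type*} [AddCommGroup E] [Module ℝ E]

theorem stepSlope_smul {τ : ℕ → ℝ} (hτ : StrictMono τ) (y : ℕ → E) (j : ℕ) :
    (τ (j + 1) - τ j) • stepSlope τ y j = y (j + 1) - y j :=
  smul_inv_smul₀ (sub_pos.2 (hτ j.lt_succ_self)).ne' _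

theorem linInterp_node {τ : ℕ → ℝ} (hτ : StrictMono τ) {N j : ℕ} (hj : j ≤ N) (y : ℕ → E) :
    linInterp τ N y (τ j) = y j := by
  simp [linInterp, stepIndex_eq hτ hj le_rfl (hτ j.lt_succ_self)]

theorem linInterp_eq {τ : ℕ → ℝ} (hτ : StrictMono τ) {N j : ℕ} (hj : j < N) (y : ℕ → E) {t : ℝ}
    (ht : t ∈ Icc (τ j) (τ (j + 1))) :
    linInterp τ N y t = y j + (t - τ j) • stepSlope τ y j := by
  rcases ht.2.lt_or_eq with h | rfl
  · simp [linInterp, stepIndex_eq hτ hj.le ht.1 h]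
  · rw [linInterp_node hτ hj, stepSlope_smul hτ, add_sub_cancel]

end LinInterp

namespace IsMesh

variable {T C : ℝ} {N : ℕ} {τ : ℕ → ℝ}

theorem mem_Icc (h : IsMesh T C N τ) {j : ℕ} (hj : j ≤ N) : τ j ∈ Icc 0 T :=
  ⟨h.zero ▸ h.strictMono.monotone j.zero_le, h.last ▸ h.strictMono.monotone hj⟩

theorem step_pos (h : IsMesh T C N τ) (j : ℕ) : 0 < τ (j + 1) - τ j :=
  sub_pos.2 (h.strictMono j.lt_succ_self)

theorem Icc_subset (h : IsMesh T C N τ) {j : ℕ} (hj : j < N) :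
    Icc (τ j) (τ (j + 1)) ⊆ Icc 0 T :=
  Icc_subset_Icc (h.mem_Icc hj.le).1 (h.mem_Icc hj).2

theorem exists_mem_Icc (h : IsMesh T C N τ) (hN : 0 < N) {t : ℝ} (ht : t ∈ Icc 0 T) :
    ∃ j < N, t ∈ Icc (τ j) (τ (j + 1)) := by
  rcases ht.2.lt_or_eq with hlt | rfl
  · have h0 : τ 0 ≤ t := h.zero.trans_le ht.1
    have h₁ : τ (stepIndex τ N t) ≤ t :=
      Nat.findGreatest_spec (P := fun j => τ j ≤ t) N.zero_le h0
    have h₂ : stepIndex τ N t < N :=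
      h.strictMono.lt_iff_lt.1 ((h₁.trans_lt hlt).trans_eq h.last.symm)
    exact ⟨_, h₂, h₁, (not_le.1 (Nat.findGreatest_is_greatest (P := fun j => τ j ≤ t)
      (Nat.lt_succ_self _) h₂)).le⟩
  · obtain ⟨j, rfl⟩ := Nat.exists_eq_succ_of_ne_zero hN.ne'
    exact ⟨j, j.lt_succ_self, h.last ▸ h.strictMono.monotone j.le_succ, h.last.ge⟩

theorem mono_const (h : IsMesh T C N τ) {C' : ℝ} (hC : C ≤ C') : IsMesh T C' N τ :=
  ⟨h.strictMono, h.zero, h.last, fun j hj => (h.step_le j hj).trans (by gcongr)⟩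

end IsMesh

theorem exists_mem_Ioo_of_ae_restrict {T : ℝ} {p : ℝ → Prop}
    (hp : ∀ᵐ t ∂(volume.restrict (Icc (0 : ℝ) T)), p t) {a b : ℝ} (ha : 0 ≤ a) (hab : a < b)
    (hb : b ≤ T) : ∃ t ∈ Ioo a b, p t := by
  by_contra! hc
  have h0 : volume (Ioo a b) ≠ 0 := by simpa using hab
  apply h0
  have := (ae_restrict_iff' measurableSet_Icc).1 hp
  refine measure_mono_null (fun t ht => ?_) (ae_iff.1 this)
  exact fun h => hc t ht (h ⟨ha.trans ht.1.le, ht.2.le.trans hb⟩)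

theorem exists_isMesh_of_ae {T : ℝ} (hT : 0 < T) {p : ℝ → Prop}
    (hp : ∀ᵐ t ∂(volume.restrict (Icc (0 : ℝ) T)), p t) {N : ℕ} (hN : 0 < N) :
    ∃ τ, IsMesh T (2 * T) N τ ∧ ∀ j, 0 < j → j < N → p (τ j) := by
  have hN' : (0 : ℝ) < N := Nat.cast_pos.2 hN
  have hs : 0 < T / N := div_pos hT hN'
  have key : ∀ j : ℕ, ∃ s, j * (T / N) ≤ s ∧ s < (j + 1) * (T / N) ∧
      (j = 0 ∨ j = N → s = j * (T / N)) ∧ (0 < j → j < N → p s) := by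
    intro j
    have hlt : j * (T / N) < (j + 1) * (T / N) := by nlinarith
    by_cases hj : 0 < j ∧ j < N
    · have hj' : (j : ℝ) + 1 ≤ N := by exact_mod_cast hj.2
      obtain ⟨s, hs, hps⟩ := exists_mem_Ioo_of_ae_restrict hp (by positivity) hlt
        (calc (j + 1) * (T / N) ≤ N * (T / N) := by gcongr
          _ = T := by field_simp)
      exact ⟨s, hs.1.le, hs.2, by omega, fun _ _ => hps⟩
    · exact ⟨_, le_rfl, hlt, fun _ => rfl, fun h₁ h₂ => absurd ⟨h₁, h₂⟩ hj⟩
  choose τ h₁ h₂ h₃ h₄ using key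
  refine ⟨τ, ⟨strictMono_nat_of_lt_succ fun j => (h₂ j).trans_le ?_, ?_, ?_, fun j _ => ?_⟩, h₄⟩
  · exact_mod_cast h₁ (j + 1)
  · simpa using h₃ 0 (Or.inl rfl)
  · rw [h₃ N (Or.inr rfl)]; field_simp
  · have h := h₂ (j + 1)
    push_cast at h
    have := h₁ j
    have : 2 * T / N = 2 * (T / N) := by ring
    nlinarith

end Mesh

section Variation

variable {E : Type*} [NormedAddCommGroup E]

theorem exists_norm_sub_le_variation_sub {f : ℝ → E} {T K : ℝ} (hT : 0 ≤ T) (hK : 0 ≤ K)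
    (hf : eVariationOn f (Icc 0 T) ≤ ENNReal.ofReal K) :
    ∃ V : ℝ → ℝ, V T - V 0 ≤ K ∧
      ∀ s ∈ Icc 0 T, ∀ t ∈ Icc 0 T, s ≤ t → ‖f t - f s‖ ≤ V t - V s := by
  have hb : BoundedVariationOn f (Icc 0 T) := (hf.trans_lt ENNReal.ofReal_lt_top).ne
  have hl := hb.locallyBoundedVariationOn
  have h0 : (0 : ℝ) ∈ Icc 0 T := ⟨le_rfl, hT⟩
  refine ⟨variationOnFromTo f (Icc 0 T) 0, ?_, fun s hs t ht hst => ?_⟩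
  · rw [variationOnFromTo.self, sub_zero]
    refine (le_abs_self _).trans ((variationOnFromTo.abs_le_eVariationOn hb).trans ?_)
    exact ENNReal.toReal_le_of_le_ofReal hK hf
  · rw [variationOnFromTo.sub_right hl h0 ht hs, variationOnFromTo.eq_of_le _ _ hst,
      ← dist_eq_norm, dist_edist]
    exact ENNReal.toReal_mono (hl s t hs ht)
      (eVariationOn.edist_le f ⟨ht, hst, le_rfl⟩ ⟨hs, le_rfl, hst⟩)

theorem abs_sum_integral_norm_sq_le {T C : ℝ} {N : ℕ} {τ ε : ℕ → ℝ} (hτ : IsMesh T C N τ)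
    (hC : 0 ≤ C) (hε₀ : ∀ j < N, 0 ≤ ε j) (hε : ∑ j ∈ Finset.range N, ε j ≤ C) {s : ℕ → E}
    {f' : ℝ → E} (h : ∀ j < N, ∀ t ∈ Icc (τ j) (τ (j + 1)), ‖s j - f' t‖ ≤ ε j) :
    |∑ j : Fin N, ∫ t in (τ j)..(τ (j + 1)), ‖s j - f' t‖ ^ 2| ≤ C * C * C / N := by
  rw [Fin.sum_univ_eq_sum_range (fun j => ∫ t in (τ j)..(τ (j + 1)), ‖s j - f' t‖ ^ 2)]
  have hle : ∀ j < N, ε j ≤ C := fun j hj => (Finset.single_le_sum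
    (fun i hi => hε₀ i (Finset.mem_range.1 hi)) (Finset.mem_range.2 hj)).trans hε
  calc _ ≤ ∑ j ∈ Finset.range N, |∫ t in (τ j)..(τ (j + 1)), ‖s j - f' t‖ ^ 2| :=
        Finset.abs_sum_le_sum_abs _ _
    _ ≤ ∑ j ∈ Finset.range N, ε j * (C * (C / N)) := by
        refine Finset.sum_le_sum fun j hj => ?_
        rw [Finset.mem_range] at hj
        have hp := hτ.step_pos j
        have hb : ‖∫ t in (τ j)..(τ (j + 1)), ‖s j - f' t‖ ^ 2‖
            ≤ ε j * C * |τ (j + 1) - τ j| := by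
          refine intervalIntegral.norm_integral_le_of_norm_le_const fun t ht => ?_
          rw [uIoc_of_le (sub_pos.1 hp).le] at ht
          have := h j hj t (Ioc_subset_Icc_self ht)
          rw [norm_pow, norm_norm, pow_two]
          exact mul_le_mul this (this.trans (hle j hj)) (norm_nonneg _) (hε₀ j hj)
        rw [Real.norm_eq_abs, abs_of_pos hp] at hb
        rw [← mul_assoc]
        exact hb.trans (mul_le_mul_of_nonneg_left (hτ.step_le j hj)
          (mul_nonneg (hε₀ j hj) hC))
    _ ≤ C * (C * (C / N)) := by
        rw [← Finset.sum_mul]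
        gcongr
    _ = C * C * C / N := by ring

end Variation

section Arc

variable {E : Type*} [NormedAddCommGroup E] [NormedSpace ℝ E] [CompleteSpace E]

theorem IsW12On.intervalIntegrable {T : ℝ} {f f' : ℝ → E} (hf : IsW12On T f f') {s t : ℝ}
    (hs : s ∈ Icc 0 T) (ht : t ∈ Icc 0 T) : IntervalIntegrable f' volume s t := by
  have h : IntegrableOn f' (Icc 0 T) := hf.1.integrable (by norm_num)
  exact (h.mono_set (uIcc_subset_Icc hs ht)).intervalIntegrable

theorem IsW12On.sub_eq_integral {T : ℝ} {f f' : ℝ → E} (hf : IsW12On T f f') {s t : ℝ}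
    (hs : s ∈ Icc 0 T) (ht : t ∈ Icc 0 T) : f t - f s = ∫ r in s..t, f' r := by
  have h0 : (0 : ℝ) ∈ Icc 0 T := ⟨le_rfl, hs.1.trans hs.2⟩
  rw [hf.2 t ht, hf.2 s hs, add_sub_add_left_eq_sub,
    intervalIntegral.integral_interval_sub_left (hf.intervalIntegrable h0 ht)
      (hf.intervalIntegrable h0 hs)]

theorem IsW12On.norm_smul_sub_le {T : ℝ} {f f' : ℝ → E} (hf : IsW12On T f f') {s t : ℝ}
    (hs : s ∈ Icc 0 T) (ht : t ∈ Icc 0 T) (hst : s ≤ t) {c : E} {ε : ℝ}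
    (h : ∀ r ∈ Icc s t, ‖c - f' r‖ ≤ ε) : ‖(t - s) • c - (f t - f s)‖ ≤ (t - s) * ε := by
  rw [hf.sub_eq_integral hs ht, ← intervalIntegral.integral_const,
    ← intervalIntegral.integral_sub intervalIntegrable_const (hf.intervalIntegrable hs ht)]
  refine (intervalIntegral.norm_integral_le_of_norm_le_const fun r hr => h r ?_).trans_eq ?_
  · rw [uIoc_of_le hst] at hr
    exact Ioc_subset_Icc_self hr
  · rw [abs_of_nonneg (sub_nonneg.2 hst), mul_comm]

/-- The values `y` at the mesh points `τ` approximate the arc `f` up to `C / N`, with slopes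
approximating the derivative `f'` up to `ε j` on the `j`-th mesh interval. -/
structure IsCloseArc (C : ℝ) (N : ℕ) (τ ε : ℕ → ℝ) (y : ℕ → E) (f f' : ℝ → E) : Prop where
  node : ∀ j ≤ N, ‖y j - f (τ j)‖ ≤ C / N
  slope : ∀ j < N, ∀ t ∈ Icc (τ j) (τ (j + 1)), ‖stepSlope τ y j - f' t‖ ≤ ε j

theorem norm_stepSlope_sub_le {T C : ℝ} {N : ℕ} {τ : ℕ → ℝ} (hτ : IsMesh T C N τ)
    {f f' : ℝ → E} (hf : IsW12On T f f') {V : ℝ → ℝ}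
    (hV : ∀ s ∈ Icc 0 T, ∀ t ∈ Icc 0 T, s ≤ t → ‖f' t - f' s‖ ≤ V t - V s)
    {j : ℕ} (hj : j < N) {t : ℝ}
    (ht : t ∈ Icc (τ j) (τ (j + 1))) :
    ‖stepSlope τ (fun i => f (τ i)) j - f' t‖ ≤ V (τ (j + 1)) - V (τ j) := by
  have hm : MonotoneOn V (Icc 0 T) := fun s hs t ht hst =>
    sub_nonneg.1 ((norm_nonneg _).trans (hV s hs t ht hst))
  have hp := hτ.step_pos j
  have hj₀ := hτ.mem_Icc hj.le
  have hj₁ := hτ.mem_Icc (Nat.succ_le_of_lt hj)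
  have key : ∀ s ∈ Icc (τ j) (τ (j + 1)), ∀ t ∈ Icc (τ j) (τ (j + 1)), s ≤ t →
      ‖f' t - f' s‖ ≤ V (τ (j + 1)) - V (τ j) := fun s hs t ht hst =>
    (hV s (hτ.Icc_subset hj hs) t (hτ.Icc_subset hj ht) hst).trans
      (sub_le_sub (hm (hτ.Icc_subset hj ht) hj₁ ht.2) (hm hj₀ (hτ.Icc_subset hj hs) hs.1))
  have h := hf.norm_smul_sub_le hj₀ hj₁ (sub_pos.1 hp).le (c := f' t)
    (ε := V (τ (j + 1)) - V (τ j)) fun r hr => by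
      rcases le_total r t with h | h
      · exact key r hr t ht h
      · rw [norm_sub_rev]; exact key t ht r hr h
  rw [← stepSlope_smul hτ.strictMono (fun i => f (τ i)), ← smul_sub, norm_smul,
    Real.norm_of_nonneg hp.le, norm_sub_rev] at h
  exact le_of_mul_le_mul_left h hp

theorem IsCloseArc.norm_linInterp_sub_le {T C : ℝ} {N : ℕ} (hN : 0 < N) {τ ε : ℕ → ℝ}
    (hτ : IsMesh T C N τ) (hC : 0 ≤ C) (hε : ∀ j < N, ε j ≤ C) {y : ℕ → E}
    {f f' : ℝ → E} (hf : IsW12On T f f') (h : IsCloseArc C N τ ε y f f') {t : ℝ}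
    (ht : t ∈ Icc 0 T) : ‖linInterp τ N y t - f t‖ ≤ (C + C * C) / N := by
  obtain ⟨j, hj, htj⟩ := hτ.exists_mem_Icc hN ht
  have h₁ := hf.norm_smul_sub_le (hτ.mem_Icc hj.le) ht htj.1 (c := stepSlope τ y j) (ε := C)
    fun r hr => (h.slope j hj r ⟨hr.1, hr.2.trans htj.2⟩).trans (hε j hj)
  have h₂ := hτ.step_le j hj
  rw [linInterp_eq hτ.strictMono hj y htj,
    show y j + (t - τ j) • stepSlope τ y j - f t
      = (y j - f (τ j)) + ((t - τ j) • stepSlope τ y j - (f t - f (τ j))) by abel]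
  calc _ ≤ C / N + (t - τ j) * C := (norm_add_le _ _).trans (add_le_add (h.node j hj.le) h₁)
    _ ≤ C / N + C / N * C := by
      gcongr
      linarith [htj.2]
    _ = (C + C * C) / N := by ring

end Arc
section Gronwall

theorem IsMesh.le_exp_mul_sum {T C : ℝ} {N : ℕ} {τ : ℕ → ℝ} (hτ : IsMesh T C N τ) (hC : 0 ≤ C)
    {L : ℝ} (hL : 0 ≤ L) {e D : ℕ → ℝ} (hD : ∀ j < N, 0 ≤ D j) (h0 : e 0 = 0)
    (hs : ∀ j < N, e (j + 1) ≤ e j + (τ (j + 1) - τ j) * (L * e j + D j)) {j : ℕ} (hj : j ≤ N) :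
    e j ≤ Real.exp (L * τ j) * (C / N * ∑ i ∈ Finset.range j, D i) := by
  induction j with
  | zero => simp [h0]
  | succ j ih =>
    have hj' : j < N := hj
    have hp := hτ.step_pos j
    have hS : 0 ≤ C / N * ∑ i ∈ Finset.range j, D i :=
      mul_nonneg (by positivity)
        (Finset.sum_nonneg fun i hi => hD i ((Finset.mem_range.1 hi).trans hj'))
    have hexp : 1 + L * (τ (j + 1) - τ j) ≤ Real.exp (L * (τ (j + 1) - τ j)) := by
      rw [add_comm]; exact Real.add_one_le_exp _
    have h1 : 1 ≤ Real.exp (L * τ (j + 1)) :=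
      Real.one_le_exp (mul_nonneg hL (hτ.mem_Icc hj).1)
    calc e (j + 1) ≤ (1 + L * (τ (j + 1) - τ j)) * e j + (τ (j + 1) - τ j) * D j := by
          linarith [hs j hj']
      _ ≤ (1 + L * (τ (j + 1) - τ j)) *
            (Real.exp (L * τ j) * (C / N * ∑ i ∈ Finset.range j, D i)) + C / N * D j := by
          have := mul_nonneg hL hp.le
          gcongr
          · exact ih hj'.le
          · exact hD j hj'
          · exact hτ.step_le j hj'
      _ ≤ Real.exp (L * (τ (j + 1) - τ j)) *
            (Real.exp (L * τ j) * (C / N * ∑ i ∈ Finset.range j, D i)) +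
            Real.exp (L * τ (j + 1)) * (C / N * D j) := by
          refine add_le_add (mul_le_mul_of_nonneg_right hexp (by positivity)) ?_
          exact le_mul_of_one_le_left (mul_nonneg (by positivity) (hD j hj')) h1
      _ = _ := by
          rw [← mul_assoc, ← Real.exp_add, Finset.sum_range_succ]
          ring_nf

end Gronwall

section NormalCone

theorem mem_normalCone_polyhedron_translate {n m : ℕ} {a : Fin m → En n} {b : Fin m → ℝ}
    {x w : En n} (h : w ∈ normalCone (polyhedron a b) x) (y : En n) :
    w ∈ normalCone (polyhedron a fun i => b i + ⟪a i, y - x⟫) y := by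
  refine ⟨fun i => ?_, fun z hz => ?_⟩
  · have := h.1 i
    simp only [inner_sub_right]
    linarith
  · have hmem : z - (y - x) ∈ polyhedron a b := fun i => by
      have := hz i
      simp only [inner_sub_right] at this ⊢
      linarith
    have := h.2 _ hmem
    rwa [show z - (y - x) - x = z - y by abel] at this

theorem zero_mem_normalCone {E : Type*} [NormedAddCommGroup E] [InnerProductSpace ℝ E]
    {C : Set E} {x : E} (h : x ∈ C) : (0 : E) ∈ normalCone C x :=
  ⟨h, fun y _ => by simp⟩

end NormalCone

section Slope

variable {E : Type*} [AddCommGroup E] [Module ℝ E]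

theorem stepSlope_add (τ : ℕ → ℝ) (y z : ℕ → E) (j : ℕ) :
    stepSlope τ (fun i => y i + z i) j = stepSlope τ y j + stepSlope τ z j := by
  rw [stepSlope, stepSlope, stepSlope, ← smul_add]
  congr 1
  abel

theorem stepSlope_sub (τ : ℕ → ℝ) (y z : ℕ → E) (j : ℕ) :
    stepSlope τ (fun i => y i - z i) j = stepSlope τ y j - stepSlope τ z j := by
  rw [stepSlope, stepSlope, stepSlope, ← smul_sub]
  congr 1
  abel

theorem stepSlope_apply {ι : Type*} (τ : ℕ → ℝ) (y : ℕ → ι → E) (j : ℕ) (i : ι) :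
    stepSlope τ y j i = stepSlope τ (fun l => y l i) j := rfl

theorem stepSlope_inner {F : Type*} [NormedAddCommGroup F] [InnerProductSpace ℝ F] (τ : ℕ → ℝ)
    (y z : ℕ → F) (j : ℕ) :
    stepSlope τ (fun i => ⟪y i, z i⟫) j
      = ⟪stepSlope τ y j, z (j + 1)⟫ + ⟪y j, stepSlope τ z j⟫ := by
  simp only [stepSlope, real_inner_smul_left, real_inner_smul_right, inner_sub_left,
    inner_sub_right, smul_eq_mul]
  ring

theorem norm_stepSlope_inner_le {n m : ℕ} {τ : ℕ → ℝ} {y : ℕ → Fin m → En n} {z : ℕ → En n}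
    {j : ℕ} {A p q : ℝ} (hA : ‖stepSlope τ y j‖ ≤ A) (hp : ‖z (j + 1)‖ ≤ p)
    (hy : ∀ i, ‖y j i‖ ≤ 1) (hq : ‖stepSlope τ z j‖ ≤ q) :
    ‖stepSlope τ (fun l i => ⟪y l i, z l⟫) j‖ ≤ A * p + q := by
  have hA' := (norm_nonneg _).trans hA
  have hp' := (norm_nonneg _).trans hp
  have hq' := (norm_nonneg _).trans hq
  refine (pi_norm_le_iff_of_nonneg (by positivity)).2 fun i => ?_
  rw [stepSlope_apply, stepSlope_inner τ (fun l => y l i)]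
  refine (norm_add_le _ _).trans (add_le_add ?_ ?_)
  · refine (norm_inner_le_norm _ _).trans (mul_le_mul ?_ hp (norm_nonneg _) hA')
    rw [← stepSlope_apply]
    exact (norm_le_pi_norm _ i).trans hA
  · refine (norm_inner_le_norm _ _).trans ?_
    calc _ ≤ 1 * q := mul_le_mul (hy i) hq (norm_nonneg _) zero_le_one
      _ = q := one_mul q

end Slope

/-- The mesh values of the explicit scheme with prescribed normal vectors `w`. -/
def sweepingIterate {E F : Type*} [AddCommGroup E] [Module ℝ E] (g : E → F → E) (τ : ℕ → ℝ)
    (u : ℝ → F) (w : ℝ → E) (x₀ : E) : ℕ → E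
  | 0 => x₀
  | j + 1 => sweepingIterate g τ u w x₀ j + (τ (j + 1) - τ j) •
      (g (sweepingIterate g τ u w x₀ j) (u (τ j)) - w (τ j))

theorem stepSlope_sweepingIterate {E F : Type*} [AddCommGroup E] [Module ℝ E] (g : E → F → E)
    {τ : ℕ → ℝ} (hτ : StrictMono τ) (u : ℝ → F) (w : ℝ → E) (x₀ : E) (j : ℕ) :
    stepSlope τ (sweepingIterate g τ u w x₀) j
      = g (sweepingIterate g τ u w x₀ j) (u (τ j)) - w (τ j) := by
  rw [stepSlope, sweepingIterate, add_sub_cancel_left,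
    inv_smul_smul₀ (sub_pos.2 (hτ j.lt_succ_self)).ne']

theorem IsMesh.sum_sub_add_le {T C : ℝ} {N : ℕ} {τ : ℕ → ℝ} (hτ : IsMesh T C N τ) {V : ℝ → ℝ}
    {K B : ℝ} (hK : V T - V 0 ≤ K) {β : ℕ → ℝ} (hβ : ∑ j ∈ Finset.range N, β j ≤ B) :
    ∑ j ∈ Finset.range N, (V (τ (j + 1)) - V (τ j) + β j) ≤ K + B := by
  rw [Finset.sum_add_distrib, Finset.sum_range_sub (fun j => V (τ j)), hτ.zero, hτ.last]
  exact add_le_add hK hβ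

theorem isCloseArc_sweepingIterate {n m : ℕ} {F : Type*} {T : ℝ} (hT : 0 ≤ T) {N : ℕ}
    {τ : ℕ → ℝ} (hτ : IsMesh T (2 * T) N τ) {g : En n → F → En n} {U : Set F} {L : ℝ}
    (hL : 0 ≤ L) (hg : ∀ x y, ∀ u ∈ U, ‖g x u - g y u‖ ≤ L * ‖x - y‖)
    {xb xb' : ℝ → En n} {ab ab' : ℝ → Fin m → En n} {bb bb' : ℝ → Fin m → ℝ}
    (hxb : IsW12On T xb xb') (hab : IsW12On T ab ab') (hbb : IsW12On T bb bb')
    (hnorm : ∀ t ∈ Icc 0 T, ∀ i, ‖ab t i‖ = 1) {V : ℝ → ℝ} {K : ℝ} (hK : V T - V 0 ≤ K)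
    (hVx : ∀ s ∈ Icc 0 T, ∀ t ∈ Icc 0 T, s ≤ t → ‖xb' t - xb' s‖ ≤ V t - V s)
    (hVa : ∀ s ∈ Icc 0 T, ∀ t ∈ Icc 0 T, s ≤ t → ‖ab' t - ab' s‖ ≤ V t - V s)
    (hVb : ∀ s ∈ Icc 0 T, ∀ t ∈ Icc 0 T, s ≤ t → ‖bb' t - bb' s‖ ≤ V t - V s)
    {u : ℝ → F} {w : ℝ → En n} (hu : ∀ t, u t ∈ U) {β : ℕ → ℝ} {B : ℝ} (hβ₀ : ∀ j, 0 ≤ β j)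
    (hβ : ∑ j ∈ Finset.range N, β j ≤ B)
    (hw : ∀ j < N, ‖g (xb (τ j)) (u (τ j)) - w (τ j) - xb' (τ j)‖ ≤ β j)
    {X : ℕ → En n} (hX : X = sweepingIterate g τ u w (xb 0)) {Γ : ℝ}
    (hΓ : Γ = Real.exp (L * T) * (2 * T * (K + B))) {ε : ℕ → ℝ}
    (hε : ∀ j, ε j = (‖ab' 0‖ + K + L) * (Γ / N) + 2 * (V (τ (j + 1)) - V (τ j) + β j)) :
    IsCloseArc Γ N τ ε X xb xb' ∧ IsCloseArc Γ N τ ε (fun j => ab (τ j)) ab ab' ∧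
      IsCloseArc Γ N τ ε (fun j i => bb (τ j) i + ⟪ab (τ j) i, X j - xb (τ j)⟫) bb bb' := by
  have h0T : (0 : ℝ) ∈ Icc 0 T := ⟨le_rfl, hT⟩
  have hm : MonotoneOn V (Icc 0 T) := fun s hs t ht hst =>
    sub_nonneg.1 ((norm_nonneg _).trans (hVx s hs t ht hst))
  have hVK : ∀ s ∈ Icc 0 T, ∀ t ∈ Icc 0 T, V t - V s ≤ K := fun s hs t ht =>
    (sub_le_sub (hm ht ⟨hT, le_rfl⟩ ht.2) (hm h0T hs hs.1)).trans hK
  have hdV : ∀ j < N, 0 ≤ V (τ (j + 1)) - V (τ j) := fun j hj => sub_nonneg.2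
    (hm (hτ.mem_Icc hj.le) (hτ.mem_Icc hj) (hτ.strictMono.monotone j.le_succ))
  have hK₀ : 0 ≤ K := (sub_self (V 0)).ge.trans (hVK 0 h0T 0 h0T)
  have hB₀ : 0 ≤ B := (Finset.sum_nonneg fun i _ => hβ₀ i).trans hβ
  have hΓ₀ : 0 ≤ Γ := by rw [hΓ]; positivity
  set e : ℕ → En n := fun j => X j - xb (τ j) with he
  have hslopeX : ∀ j < N, ‖stepSlope τ X j - xb' (τ j)‖ ≤ L * ‖e j‖ + β j := fun j hj => by
    rw [hX, stepSlope_sweepingIterate g hτ.strictMono, ← hX,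
      show g (X j) (u (τ j)) - w (τ j) - xb' (τ j) = (g (X j) (u (τ j)) - g (xb (τ j)) (u (τ j)))
        + (g (xb (τ j)) (u (τ j)) - w (τ j) - xb' (τ j)) by abel]
    exact (norm_add_le _ _).trans (add_le_add (hg _ _ _ (hu _)) (hw j hj))
  have hslope_e : ∀ j < N, ‖stepSlope τ e j‖
      ≤ L * ‖e j‖ + (V (τ (j + 1)) - V (τ j) + β j) := fun j hj => by
    have h₁ := hslopeX j hj
    have h₂ := norm_stepSlope_sub_le hτ hxb hVx hj ⟨le_rfl, hτ.strictMono.monotone j.le_succ⟩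
    rw [he, stepSlope_sub]
    have := norm_sub_le_norm_sub_add_norm_sub (stepSlope τ X j) (xb' (τ j))
      (stepSlope τ (fun i => xb (τ i)) j)
    rw [norm_sub_rev (xb' (τ j))] at this
    linarith
  have hstep : ∀ j < N, ‖e (j + 1)‖ ≤ ‖e j‖ +
      (τ (j + 1) - τ j) * (L * ‖e j‖ + (V (τ (j + 1)) - V (τ j) + β j)) := fun j hj => by
    have hp := hτ.step_pos j
    have h := norm_add_le (e j) ((τ (j + 1) - τ j) • stepSlope τ e j)
    rw [stepSlope_smul hτ.strictMono, add_sub_cancel, ← stepSlope_smul hτ.strictMono, norm_smul,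
      Real.norm_of_nonneg hp.le] at h
    exact h.trans (add_le_add_right (mul_le_mul_of_nonneg_left (hslope_e j hj) hp.le) _)
  have hD : ∀ j < N, 0 ≤ V (τ (j + 1)) - V (τ j) + β j := fun j hj =>
    add_nonneg (hdV j hj) (hβ₀ j)
  have he_le : ∀ j ≤ N, ‖e j‖ ≤ Γ / N := fun j hj => by
    refine (hτ.le_exp_mul_sum (by positivity) hL hD (e := fun j => ‖e j‖)
      (by simp [he, hX, sweepingIterate, hτ.zero]) hstep hj).trans ?_
    calc _ ≤ Real.exp (L * T) * (2 * T / N * (K + B)) := by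
          have hsum : ∑ i ∈ Finset.range j, (V (τ (i + 1)) - V (τ i) + β i) ≤ K + B :=
            (Finset.sum_le_sum_of_subset_of_nonneg (Finset.range_mono hj)
              fun i hi _ => hD i (Finset.mem_range.1 hi)).trans (hτ.sum_sub_add_le hK hβ)
          gcongr
          · exact mul_nonneg (by positivity) (Finset.sum_nonneg fun i hi =>
              hD i ((Finset.mem_range.1 hi).trans_le hj))
          · exact (hτ.mem_Icc hj).2
      _ = Γ / N := by rw [hΓ]; ring
  have hnode₀ : 0 ≤ Γ / N := by positivity
  have hA : ∀ j < N, ‖stepSlope τ (fun i => ab (τ i)) j‖ ≤ ‖ab' 0‖ + K := fun j hj => by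
    have h₁ := norm_stepSlope_sub_le hτ hab hVa hj ⟨le_rfl, hτ.strictMono.monotone j.le_succ⟩
    have h₂ := hVa 0 h0T _ (hτ.mem_Icc hj.le) (hτ.mem_Icc hj.le).1
    have h₃ := hVK 0 h0T _ (hτ.mem_Icc hj)
    have h₄ := norm_sub_norm_le (stepSlope τ (fun i => ab (τ i)) j) (ab' (τ j))
    have h₅ := norm_sub_norm_le (ab' (τ j)) (ab' 0)
    linarith
  have hLe : ∀ j ≤ N, L * ‖e j‖ ≤ L * (Γ / N) := fun j hj =>
    mul_le_mul_of_nonneg_left (he_le j hj) hL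
  have hA₀ : 0 ≤ (‖ab' 0‖ + K) * (Γ / N) := by positivity
  have hL₀ : 0 ≤ L * (Γ / N) := by positivity
  refine ⟨⟨he_le, fun j hj t ht => ?_⟩, ⟨fun j _ => by simpa using hnode₀, fun j hj t ht => ?_⟩,
    ⟨fun j hj => ?_, fun j hj t ht => ?_⟩⟩
  · have h₁ := hslopeX j hj
    have h₂ := hVx _ (hτ.mem_Icc hj.le) t (hτ.Icc_subset hj ht) ht.1
    have h₃ := hm (hτ.Icc_subset hj ht) (hτ.mem_Icc hj) ht.2
    have h₄ := norm_sub_le_norm_sub_add_norm_sub (stepSlope τ X j) (xb' (τ j)) (xb' t)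
    rw [norm_sub_rev (xb' (τ j))] at h₄
    rw [hε]
    linarith [hLe j hj.le, hdV j hj, hβ₀ j]
  · have h := norm_stepSlope_sub_le hτ hab hVa hj ht
    rw [hε]
    linarith [hdV j hj, hβ₀ j]
  · refine (pi_norm_le_iff_of_nonneg hnode₀).2 fun i => ?_
    rw [Pi.sub_apply, add_sub_cancel_left]
    refine (norm_inner_le_norm _ _).trans ?_
    rw [hnorm _ (hτ.mem_Icc hj), one_mul]
    exact he_le j hj
  · have h₁ := norm_stepSlope_sub_le hτ hbb hVb hj ht
    have h₂ := norm_stepSlope_inner_le (y := fun l => ab (τ l)) (hA j hj) (he_le (j + 1) hj)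
      (fun i => (hnorm _ (hτ.mem_Icc hj.le) i).le) (hslope_e j hj)
    have h₃ := stepSlope_add τ (fun l => bb (τ l)) (fun l i => ⟪ab (τ l) i, e l⟫) j
    have h₄ := norm_add_le (stepSlope τ (fun l => bb (τ l)) j - bb' t)
      (stepSlope τ (fun l i => ⟪ab (τ l) i, e l⟫) j)
    rw [sub_add_eq_add_sub, ← h₃] at h₄
    rw [hε]
    refine h₄.trans ?_
    linarith [hLe j hj.le, hdV j hj, hβ₀ j]

section Convergence

theorem tendsto_const_div_succ (C : ℝ) :
    Tendsto (fun k : ℕ => C / ((k + 1 : ℕ) : ℝ)) atTop (𝓝 0) :=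
  (tendsto_const_div_atTop_nhds_zero_nat C).comp (tendsto_add_atTop_nat 1)

theorem tendstoUniformlyOn_linInterp {E : Type*} [NormedAddCommGroup E] [NormedSpace ℝ E]
    [CompleteSpace E] {T C : ℝ} {τ ε : ℕ → ℕ → ℝ} (hτ : ∀ k, IsMesh T C (k + 1) (τ k))
    (hC : 0 ≤ C) (hε : ∀ k, ∀ j < k + 1, ε k j ≤ C) {y : ℕ → ℕ → E} {f f' : ℝ → E}
    (hf : IsW12On T f f') (h : ∀ k, IsCloseArc C (k + 1) (τ k) (ε k) (y k) f f') :
    TendstoUniformlyOn (fun k => linInterp (τ k) (k + 1) (y k)) f atTop (Icc 0 T) := by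
  refine Metric.tendstoUniformlyOn_iff.2 fun r hr => ?_
  filter_upwards [(tendsto_const_div_succ (C + C * C)).eventually_lt_const hr] with k hk t ht
  rw [dist_eq_norm, norm_sub_rev]
  exact ((h k).norm_linInterp_sub_le k.succ_pos (hτ k) hC (hε k) hf ht).trans_lt hk

theorem tendsto_sum_integral_norm_sq {E : Type*} [NormedAddCommGroup E] {T C : ℝ}
    {τ ε : ℕ → ℕ → ℝ} (hτ : ∀ k, IsMesh T C (k + 1) (τ k)) (hC : 0 ≤ C)
    (hε₀ : ∀ k, ∀ j < k + 1, 0 ≤ ε k j) (hε : ∀ k, ∑ j ∈ Finset.range (k + 1), ε k j ≤ C)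
    {s : ℕ → ℕ → E} {f' : ℝ → E}
    (h : ∀ k, ∀ j < k + 1, ∀ t ∈ Icc (τ k j) (τ k (j + 1)), ‖s k j - f' t‖ ≤ ε k j) :
    Tendsto (fun k => ∑ j : Fin (k + 1),
      ∫ t in (τ k j)..(τ k (j + 1)), ‖s k j - f' t‖ ^ 2) atTop (𝓝 0) :=
  squeeze_zero_norm (fun k => abs_sum_integral_norm_sq_le (hτ k) hC (hε₀ k) (hε k) (h k))
    (tendsto_const_div_succ (C * C * C))

end Convergence

theorem IsCloseArc.mono_const {E : Type*} [NormedAddCommGroup E] [NormedSpace ℝ E]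
    {C C' : ℝ} {N : ℕ} {τ ε : ℕ → ℝ} {y : ℕ → E} {f f' : ℝ → E}
    (h : IsCloseArc C N τ ε y f f') (hC : C ≤ C') : IsCloseArc C' N τ ε y f f' :=
  ⟨fun j hj => (h.node j hj).trans (by gcongr), h.slope⟩

/-- A selection of the control and of the normal vector in the sweeping inclusion: the given ones
where the inclusion holds, the control `u₀` and the zero vector elsewhere. -/
theorem exists_control_normal {n m d : ℕ} {U : Set (En d)} {g : En n → En d → En n}
    {xb xb' : ℝ → En n} {ab : ℝ → Fin m → En n} {bb : ℝ → Fin m → ℝ} {ub : ℝ → En d} {u₀ : En d}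
    (hu₀ : u₀ ∈ U) :
    ∃ (u : ℝ → En d) (w : ℝ → En n), (∀ t, u t ∈ U) ∧ ∀ t,
      (u t = ub t ∧ w t ∈ normalCone (polyhedron (ab t) (bb t)) (xb t) ∧
        xb' t = -w t + g (xb t) (ub t)) ∨
      (u t = u₀ ∧ w t = 0 ∧ ¬(ub t ∈ U ∧ ∃ w ∈ normalCone (polyhedron (ab t) (bb t)) (xb t),
        xb' t = -w + g (xb t) (ub t))) := by
  have key : ∀ t, ∃ (u : En d) (w : En n), u ∈ U ∧
      ((u = ub t ∧ w ∈ normalCone (polyhedron (ab t) (bb t)) (xb t) ∧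
        xb' t = -w + g (xb t) (ub t)) ∨
      (u = u₀ ∧ w = 0 ∧ ¬(ub t ∈ U ∧ ∃ w ∈ normalCone (polyhedron (ab t) (bb t)) (xb t),
        xb' t = -w + g (xb t) (ub t)))) := by
    intro t
    by_cases h : ub t ∈ U ∧ ∃ w ∈ normalCone (polyhedron (ab t) (bb t)) (xb t),
        xb' t = -w + g (xb t) (ub t)
    · obtain ⟨hu, w, hw, he⟩ := h
      exact ⟨ub t, w, hu, Or.inl ⟨rfl, hw, he⟩⟩
    · exact ⟨u₀, 0, hu₀, Or.inr ⟨rfl, rfl, h⟩⟩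
  choose u w h₁ h₂ using key
  exact ⟨u, w, h₁, h₂⟩

/-- Strong discrete approximation of any feasible solution of the sweeping
control system whose derivatives and control are of bounded variation. -/
theorem strong_discrete_approximation {n m d : ℕ} (T : ℝ) (hT : 0 < T)
    (U : Set (En d)) (g : En n → En d → En n)
    -- (H1)
    (hUclosed : IsClosed U) (hUbdd : Bornology.IsBounded U)
    -- (H3)
    (hLip : ∃ L > (0:ℝ), ∀ (x₁ x₂ : En n), ∀ u₁ ∈ U, ∀ u₂ ∈ U,
      ‖g x₁ u₁ - g x₂ u₂‖ ≤ L * (‖x₁ - x₂‖ + ‖u₁ - u₂‖))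
    (hGrow : ∃ M > (0:ℝ), ∀ (x : En n), ∀ u ∈ U, ‖g x u‖ ≤ M * (1 + ‖x‖))
    -- the given feasible solution (x̄,ā,b̄,ū)
    (xb xb' : ℝ → En n) (ab ab' : ℝ → Fin m → En n) (bb bb' : ℝ → Fin m → ℝ) (ub : ℝ → En d)
    (hxb : IsW12On T xb xb') (hab : IsW12On T ab ab') (hbb : IsW12On T bb bb')
    -- (H2): uniformly bounded derivatives of the controls
    (hH2 : ∃ K2 : ℝ, ∀ᵐ t ∂(volume.restrict (Icc (0:ℝ) T)), ∀ i, ‖ab' t i‖ ≤ K2 ∧ |bb' t i| ≤ K2)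
    -- (H4)
    (hH4a : ∀ i, ∃ v v' : ℝ → ℝ, IsW12On T v v' ∧
      ∀ s ∈ Icc (0:ℝ) T, ∀ t ∈ Icc (0:ℝ) T, ‖ab t i - ab s i‖ ≤ |v t - v s|)
    (hH4b : ∃ ϑ : ℝ → ℝ, ContinuousOn ϑ (Icc (0:ℝ) T) ∧
      (∃ c < (0:ℝ), ∀ t ∈ Icc (0:ℝ) T, ϑ t ≤ c) ∧
      ∀ t ∈ Icc (0:ℝ) T, ∃ xs : En n, ∀ i, ⟪ab t i, xs⟫ - bb t i < ϑ t)
    (hub : MemLp ub 2 (volume.restrict (Icc (0:ℝ) T)))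
    (hubU : ∀ᵐ t ∂(volume.restrict (Icc (0:ℝ) T)), ub t ∈ U)
    (hincl : ∀ᵐ t ∂(volume.restrict (Icc (0:ℝ) T)),
      ∃ w ∈ normalCone (polyhedron (ab t) (bb t)) (xb t), xb' t = -w + g (xb t) (ub t))
    (hinit : xb 0 ∈ polyhedron (ab 0) (bb 0))
    (hnorm1 : ∀ t ∈ Icc (0:ℝ) T, ∀ i, ‖ab t i‖ = 1)
    -- bounded variation of the derivatives and of the control, with common bound K
    (K : ℝ) (hK : 0 < K)
    (hBVx : eVariationOn xb' (Icc (0:ℝ) T) ≤ ENNReal.ofReal K)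
    (hBVa : eVariationOn ab' (Icc (0:ℝ) T) ≤ ENNReal.ofReal K)
    (hBVb : eVariationOn bb' (Icc (0:ℝ) T) ≤ ENNReal.ofReal K)
    (hBVu : eVariationOn ub (Icc (0:ℝ) T) ≤ ENNReal.ofReal K) :
    ∃ (ν : ℕ → ℕ) (νtil : ℝ), 0 < νtil ∧ (∀ k, k ≤ ν k) ∧ (∀ k, 0 < ν k) ∧
    ∃ tm : (k : ℕ) → Fin (ν k + 1) → ℝ,
      (∀ k, StrictMono (tm k)) ∧ (∀ k, tm k 0 = 0) ∧ (∀ k, tm k (Fin.last (ν k)) = T) ∧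
      (∀ k, ∀ j : Fin (ν k), tm k j.succ - tm k j.castSucc ≤ νtil / (ν k)) ∧
    ∃ (xk : ℕ → ℝ → En n) (ak : ℕ → ℝ → Fin m → En n) (bk : ℕ → ℝ → Fin m → ℝ)
      (uk : ℕ → ℝ → En d)
      (v : (k : ℕ) → Fin (ν k) → En n) (sa : (k : ℕ) → Fin (ν k) → Fin m → En n)
      (sb : (k : ℕ) → Fin (ν k) → Fin m → ℝ) (uv : (k : ℕ) → Fin (ν k) → En d)
      (δ : ℕ → ℝ),
      (∀ k, 0 < δ k) ∧ Tendsto δ atTop (𝓝 0) ∧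
      -- fixed initial values
      (∀ k, xk k 0 = xb 0 ∧ ak k 0 = ab 0 ∧ bk k 0 = bb 0) ∧
      -- piecewise linear structure of (x^k, a^k, b^k)
      (∀ k, ∀ j : Fin (ν k), ∀ t ∈ Icc (tm k j.castSucc) (tm k j.succ),
        xk k t = xk k (tm k j.castSucc) + (t - tm k j.castSucc) • v k j ∧
        ak k t = ak k (tm k j.castSucc) + (t - tm k j.castSucc) • sa k j ∧
        bk k t = bk k (tm k j.castSucc) + (t - tm k j.castSucc) • sb k j) ∧
      -- piecewise constant structure of u^k
      (∀ k, ∀ j : Fin (ν k), ∀ t ∈ Ico (tm k j.castSucc) (tm k j.succ), uk k t = uv k j) ∧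
      (∀ k, ∀ j : Fin (ν k), uk k (tm k j.castSucc) = uv k j) ∧
      -- the discrete sweeping inclusion -v_j ∈ F(x^k(t_j), a^k(t_j), b^k(t_j), u^k(t_j))
      (∀ k, ∀ j : Fin (ν k),
        -(v k j) ∈ FmapSV g (xk k (tm k j.castSucc), ak k (tm k j.castSucc),
          WithLp.toLp 2 (fun i => bk k (tm k j.castSucc) i), uv k j)) ∧
      -- the relaxed unit-norm constraints at the mesh points
      (∀ k, ∀ j : Fin (ν k + 1), ∀ i,
        1 - δ k ≤ ‖ak k (tm k j) i‖ ∧ ‖ak k (tm k j) i‖ ≤ 1 + δ k) ∧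
      -- uniform convergence of the arcs on [0,T]
      TendstoUniformlyOn (fun k => xk k) xb atTop (Icc (0:ℝ) T) ∧
      TendstoUniformlyOn (fun k => ak k) ab atTop (Icc (0:ℝ) T) ∧
      TendstoUniformlyOn (fun k => bk k) bb atTop (Icc (0:ℝ) T) ∧
      -- L² convergence of the derivatives and of the controls
      Tendsto (fun k => ∑ j : Fin (ν k),
        ∫ t in (tm k j.castSucc)..(tm k j.succ), ‖v k j - xb' t‖ ^ 2) atTop (𝓝 0) ∧
      Tendsto (fun k => ∑ j : Fin (ν k),
        ∫ t in (tm k j.castSucc)..(tm k j.succ), ‖sa k j - ab' t‖ ^ 2) atTop (𝓝 0) ∧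
      Tendsto (fun k => ∑ j : Fin (ν k),
        ∫ t in (tm k j.castSucc)..(tm k j.succ), ‖sb k j - bb' t‖ ^ 2) atTop (𝓝 0) ∧
      Tendsto (fun k => ∑ j : Fin (ν k),
        ∫ t in (tm k j.castSucc)..(tm k j.succ), ‖uv k j - ub t‖ ^ 2) atTop (𝓝 0) := by
  obtain ⟨L, hL, hg⟩ := hLip
  obtain ⟨V₁, hV₁K, hV₁⟩ := exists_norm_sub_le_variation_sub hT.le hK.le hBVx
  obtain ⟨V₂, hV₂K, hV₂⟩ := exists_norm_sub_le_variation_sub hT.le hK.le hBVa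
  obtain ⟨V₃, hV₃K, hV₃⟩ := exists_norm_sub_le_variation_sub hT.le hK.le hBVb
  obtain ⟨V₄, hV₄K, hV₄⟩ := exists_norm_sub_le_variation_sub hT.le hK.le hBVu
  set V : ℝ → ℝ := fun t => V₁ t + V₂ t + V₃ t + V₄ t with hVdef
  have hV : ∀ s ∈ Icc 0 T, ∀ t ∈ Icc 0 T, s ≤ t →
      ‖xb' t - xb' s‖ ≤ V t - V s ∧ ‖ab' t - ab' s‖ ≤ V t - V s ∧
      ‖bb' t - bb' s‖ ≤ V t - V s ∧ ‖ub t - ub s‖ ≤ V t - V s := by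
    intro s hs t ht hst
    have h₁ := hV₁ s hs t ht hst
    have h₂ := hV₂ s hs t ht hst
    have h₃ := hV₃ s hs t ht hst
    have h₄ := hV₄ s hs t ht hst
    have := norm_nonneg (xb' t - xb' s)
    have := norm_nonneg (ab' t - ab' s)
    have := norm_nonneg (bb' t - bb' s)
    have := norm_nonneg (ub t - ub s)
    simp only [hVdef]
    refine ⟨?_, ?_, ?_, ?_⟩ <;> linarith
  have hVK : V T - V 0 ≤ 4 * K := by
    simp only [hVdef]
    linarith
  have hm : MonotoneOn V (Icc 0 T) := fun s hs t ht hst =>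
    sub_nonneg.1 ((norm_nonneg _).trans (hV s hs t ht hst).1)
  obtain ⟨t₀, -, hu₀⟩ := exists_mem_Ioo_of_ae_restrict hubU le_rfl hT le_rfl
  obtain ⟨u, w, hu, huw⟩ := exists_control_normal (g := g) (xb := xb) (xb' := xb') (ab := ab)
    (bb := bb) (ub := ub) hu₀
  choose τ hτ hgood using fun k : ℕ =>
    exists_isMesh_of_ae hT (hubU.and hincl) (Nat.succ_pos k)
  set B : ℝ := ‖g (xb 0) (ub t₀) - xb' 0‖ + ‖ub t₀ - ub 0‖ with hB
  have hB₀ : 0 ≤ B := by positivity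
  set β : ℕ → ℝ := fun j => if j = 0 then B else 0 with hβ
  have hβ₀ : ∀ j, 0 ≤ β j := fun j => by
    simp only [hβ]
    split_ifs <;> simp [hB₀]
  have hβsum : ∀ k : ℕ, ∑ j ∈ Finset.range (k + 1), β j ≤ B := fun k => by simp [hβ]
  have hwβ : ∀ k, ∀ j < k + 1,
      ‖g (xb (τ k j)) (u (τ k j)) - w (τ k j) - xb' (τ k j)‖ ≤ β j ∧
      ‖u (τ k j) - ub (τ k j)‖ ≤ β j := by
    intro k j hj
    rcases huw (τ k j) with ⟨h₁, -, h₃⟩ | ⟨h₁, h₂, h₃⟩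
    · rw [h₁, h₃, show g (xb (τ k j)) (ub (τ k j)) - w (τ k j)
        - (-w (τ k j) + g (xb (τ k j)) (ub (τ k j))) = 0 by abel]
      simpa using hβ₀ j
    · rcases j.eq_zero_or_pos with rfl | hj₀
      · rw [h₁, h₂, (hτ k).zero, sub_zero]
        simp [hβ, hB]
      · exact absurd (hgood k j hj₀ hj) h₃
  have hwcone : ∀ k, ∀ j < k + 1, w (τ k j) ∈
      normalCone (polyhedron (ab (τ k j)) (bb (τ k j))) (xb (τ k j)) := by
    intro k j hj
    rcases huw (τ k j) with ⟨-, h₂, -⟩ | ⟨-, h₂, h₃⟩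
    · exact h₂
    · rcases j.eq_zero_or_pos with rfl | hj₀
      · rw [h₂, (hτ k).zero]
        exact zero_mem_normalCone hinit
      · exact absurd (hgood k j hj₀ hj) h₃
  set Γ : ℝ := Real.exp (L * T) * (2 * T * (4 * K + B)) with hΓ
  have hΓ₀ : 0 ≤ Γ := by positivity
  set A : ℝ := ‖ab' 0‖ + 4 * K + L with hA
  have hA₀ : 0 ≤ A := by positivity
  set C : ℝ := 2 * T + Γ + (A * Γ + 2 * (4 * K + B)) with hC
  have hC₀ : 0 ≤ C := by positivity
  have hTC : 2 * T ≤ C := by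
    rw [hC, add_assoc]
    exact le_add_of_nonneg_right (by positivity)
  have hΓC : Γ ≤ C := by
    have : 0 ≤ A * Γ + 2 * (4 * K + B) := by positivity
    linarith
  set ε : ℕ → ℕ → ℝ := fun k j =>
    A * (Γ / ((k + 1 : ℕ) : ℝ)) + 2 * (V (τ k (j + 1)) - V (τ k j) + β j) with hε
  have hdV : ∀ k, ∀ j < k + 1, 0 ≤ V (τ k (j + 1)) - V (τ k j) := fun k j hj => sub_nonneg.2
    (hm ((hτ k).mem_Icc hj.le) ((hτ k).mem_Icc hj) ((hτ k).strictMono.monotone j.le_succ))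
  have hAΓ : ∀ k : ℕ, 0 ≤ A * (Γ / ((k + 1 : ℕ) : ℝ)) := fun k => by positivity
  have hε₀ : ∀ k, ∀ j < k + 1, 0 ≤ ε k j := fun k j hj => by
    simp only [hε]
    linarith [hdV k j hj, hβ₀ j, hAΓ k]
  have hεsum : ∀ k, ∑ j ∈ Finset.range (k + 1), ε k j ≤ C := fun k => by
    have h := (hτ k).sum_sub_add_le hVK (hβsum k)
    simp only [hε]
    rw [Finset.sum_add_distrib, Finset.sum_const, Finset.card_range, nsmul_eq_mul, ← Finset.mul_sum,
      show ((k + 1 : ℕ) : ℝ) * (A * (Γ / ((k + 1 : ℕ) : ℝ))) = A * Γ by field_simp]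
    linarith
  have hεC : ∀ k, ∀ j < k + 1, ε k j ≤ C := fun k j hj => (Finset.single_le_sum
    (fun i hi => hε₀ k i (Finset.mem_range.1 hi)) (Finset.mem_range.2 hj)).trans (hεsum k)
  set X : ℕ → ℕ → En n := fun k => sweepingIterate g (τ k) u w (xb 0) with hX
  set Y : ℕ → ℕ → Fin m → En n := fun k j => ab (τ k j) with hY
  set Z : ℕ → ℕ → Fin m → ℝ := fun k j i =>
    bb (τ k j) i + ⟪ab (τ k j) i, X k j - xb (τ k j)⟫ with hZ
  have hclose := fun k => isCloseArc_sweepingIterate hT.le (hτ k) hL.le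
    (fun x y u hu => by simpa using hg x y u hu u hu) hxb hab hbb hnorm1 hVK
    (fun s hs t ht hst => (hV s hs t ht hst).1) (fun s hs t ht hst => (hV s hs t ht hst).2.1)
    (fun s hs t ht hst => (hV s hs t ht hst).2.2.1) hu hβ₀ (hβsum k)
    (fun j hj => (hwβ k j hj).1) (X := X k) rfl hΓ (ε := ε k) (fun j => rfl)
  have hτC : ∀ k, IsMesh T C (k + 1) (τ k) := fun k => (hτ k).mono_const hTC
  have hsm := fun k => (hτ k).strictMono
  refine ⟨fun k => k + 1, 2 * T, by positivity, fun k => k.le_succ, fun k => k.succ_pos,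
    fun k j => τ k j, fun k i j hij => hsm k hij, fun k => (hτ k).zero, fun k => (hτ k).last,
    fun k j => (hτ k).step_le j j.2, fun k => linInterp (τ k) (k + 1) (X k),
    fun k => linInterp (τ k) (k + 1) (Y k), fun k => linInterp (τ k) (k + 1) (Z k),
    fun k t => u (τ k (stepIndex (τ k) (k + 1) t)), fun k j => stepSlope (τ k) (X k) j,
    fun k j => stepSlope (τ k) (Y k) j, fun k j => stepSlope (τ k) (Z k) j,
    fun k j => u (τ k j), fun k => 1 / ((k + 1 : ℕ) : ℝ), fun k => by positivity,
    tendsto_const_div_succ 1, fun k => ?_, fun k j t ht => ?_, fun k j t ht => ?_, fun k j => ?_,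
    fun k j => ?_, fun k j i => ?_,
    tendstoUniformlyOn_linInterp hτC hC₀ hεC hxb fun k => (hclose k).1.mono_const hΓC,
    tendstoUniformlyOn_linInterp hτC hC₀ hεC hab fun k => (hclose k).2.1.mono_const hΓC,
    tendstoUniformlyOn_linInterp hτC hC₀ hεC hbb fun k => (hclose k).2.2.mono_const hΓC,
    tendsto_sum_integral_norm_sq hτC hC₀ hε₀ hεsum fun k => (hclose k).1.slope,
    tendsto_sum_integral_norm_sq hτC hC₀ hε₀ hεsum fun k => (hclose k).2.1.slope,
    tendsto_sum_integral_norm_sq hτC hC₀ hε₀ hεsum fun k => (hclose k).2.2.slope,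
    tendsto_sum_integral_norm_sq (s := fun k j => u (τ k j)) hτC hC₀ hε₀ hεsum
      fun k j hj t ht => ?_⟩
  · have h := fun {E : Type} [AddCommGroup E] [Module ℝ E] (y : ℕ → E) =>
      linInterp_node (hsm k) (k + 1).zero_le y
    simp only [(hτ k).zero] at h
    refine ⟨h (X k), (h (Y k)).trans ?_, (h (Z k)).trans ?_⟩
    · simp [hY, (hτ k).zero]
    · funext i
      simp [hZ, hX, sweepingIterate, (hτ k).zero]
  · have h := fun {E : Type} [AddCommGroup E] [Module ℝ E] (y : ℕ → E) =>
      (linInterp_eq (hsm k) j.2 y ht).trans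
        (congrArg (· + _) (linInterp_node (hsm k) j.2.le y).symm)
    exact ⟨h (X k), h (Y k), h (Z k)⟩
  · exact congrArg (fun i => u (τ k i)) (stepIndex_eq (hsm k) j.2.le ht.1 ht.2)
  · exact congrArg (fun i => u (τ k i))
      (stepIndex_eq (hsm k) j.2.le le_rfl (hsm k (Nat.lt_succ_self _)))
  · have hx := linInterp_node (hsm k) j.2.le (X k)
    have hy := linInterp_node (hsm k) j.2.le (Y k)
    have hz := linInterp_node (hsm k) j.2.le (Z k)
    have hs : stepSlope (τ k) (X k) j = g (X k j) (u (τ k j)) - w (τ k j) :=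
      stepSlope_sweepingIterate g (hsm k) u w (xb 0) j
    refine ⟨w (τ k j), ?_, ?_⟩
    · simp only [Fin.val_castSucc, hx, hy, hz]
      exact mem_normalCone_polyhedron_translate (hwcone k j j.2) _
    · simp only [Fin.val_castSucc, hx, hs, neg_sub]
  · have hj : (j : ℕ) ≤ k + 1 := Nat.lt_succ_iff.1 j.2
    have hpos : (0 : ℝ) ≤ 1 / ((k + 1 : ℕ) : ℝ) := by positivity
    dsimp only
    rw [linInterp_node (hsm k) hj, hY, hnorm1 _ ((hτ k).mem_Icc hj)]
    constructor <;> linarith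
  · have hj₀ := (hτ k).mem_Icc hj.le
    have hj₁ := (hτ k).Icc_subset hj ht
    have h₁ := (hwβ k j hj).2
    have h₂ := (hV _ hj₀ t hj₁ ht.1).2.2.2
    have h₃ := hm hj₁ ((hτ k).mem_Icc hj) ht.2
    have h₄ := norm_sub_le_norm_sub_add_norm_sub (u (τ k j)) (ub (τ k j)) (ub t)
    rw [norm_sub_rev (ub (τ k j))] at h₄
    simp only [hε]
    linarith [hdV k j hj, hβ₀ j, hAΓ k]
end
end
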